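/- Let D be an irreducible deformation space of metric G-trees, and let D̄ be its closure in the space of nontrivial minimal ℝ-trees equipped with the equivariant Gromov-Hausdorff topology. Let T be an ℝ-tree in D̄, with length function ℓ. Then: (1) if g ∈ G is hyperbolic in D but elliptic in T, its fixed point set in T contains no tripod; (2) if g, h, and the commutator [g,h] are all hyperbolic in D, then A_g ∩ A_h is a (possibly empty or degenerate) segment of length at most ℓ(g) + ℓ(h); (3) T is irreducible; (4) D̄ is also the closure of D in the axes topology. -/

import Mathlib

set_option autoImplicit false
set_option maxHeartbeats 1000000
open scoped Classical

universe u

section Trees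

variable (G : Type u) [Group G]

/-- A (minimal, simplicial) `G`-tree: a simplicial tree together with an action of `G` by
simplicial automorphisms, without inversions, admitting no proper invariant subtree. -/
structure GTree : Type (u + 1) where
  V : Type u
  nonempty : Nonempty V
  graph : SimpleGraph V
  isTree : graph.IsTree
  act : G →* Equiv.Perm V
  adj_act : ∀ (g : G) (u v : V), graph.Adj u v → graph.Adj (act g u) (act g v)
  noInversion : ∀ (g : G) (u v : V), graph.Adj u v → ¬(act g u = v ∧ act g v = u)
  minimal : ∀ S : Set V, S.Nonempty → (∀ (g : G), ∀ v ∈ S, act g v ∈ S) →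
      (∀ u ∈ S, ∀ v ∈ S, ∀ p : graph.Walk u v, p.IsPath → ∀ w ∈ p.support, w ∈ S) →
      S = Set.univ

variable {G}

namespace GTree

variable (T : GTree G)

/-- The stabilizer of a vertex. -/
def stab (v : T.V) : Subgroup G where
  carrier := {g : G | T.act g v = v}
  one_mem' := by simp
  mul_mem' := by
    intro a b ha hb
    simp only [Set.mem_setOf_eq, map_mul, Equiv.Perm.mul_apply] at *
    rw [hb, ha]
  inv_mem' := by
    intro a ha
    simp only [Set.mem_setOf_eq] at *
    have h : T.act a⁻¹ (T.act a v) = v := by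
      rw [← Equiv.Perm.mul_apply, ← map_mul, inv_mul_cancel, map_one, Equiv.Perm.one_apply]
    rwa [ha] at h

/-- The (pointwise) stabilizer of an edge `uv`; since the action has no inversions this is
the full stabilizer of the edge. -/
def edgeStab (u v : T.V) : Subgroup G := T.stab u ⊓ T.stab v

/-- A subgroup of `G` is elliptic if it fixes a vertex. -/
def Elliptic (H : Subgroup G) : Prop := ∃ v : T.V, ∀ h ∈ H, T.act h v = v

/-- An element of `G` is elliptic if it fixes a vertex. -/
def EllipticElt (g : G) : Prop := ∃ v : T.V, T.act g v = v

/-- An element of `G` is hyperbolic if it fixes no vertex. -/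
def Hyperbolic (g : G) : Prop := ∀ v : T.V, T.act g v ≠ v

/-- A `G`-tree is reduced if whenever the stabilizer of an edge `uv` equals the stabilizer
of `u` (i.e. `G_u ≤ G_v`), the two endpoints are in the same orbit. -/
def Reduced : Prop :=
  ∀ u v : T.V, T.graph.Adj u v → T.stab u ≤ T.stab v → ∃ g : G, T.act g u = v

/-- `T` is a single point. -/
protected def Trivial : Prop := ∀ u v : T.V, u = v

/-- `T` is a (simplicial) line. -/
def IsLine : Prop := ∀ v : T.V, ∃ a b : T.V, a ≠ b ∧ {w : T.V | T.graph.Adj v w} = {a, b}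

/-- `G` fixes an end of `T`: there is an equivariant choice, for each vertex, of the next
vertex in the direction of the fixed end. -/
def FixesEnd : Prop :=
  ∃ next : T.V → T.V, (∀ v, T.graph.Adj v (next v)) ∧
    (∀ (g : G) (v : T.V), next (T.act g v) = T.act g (next v)) ∧
    (∀ v, next (next v) ≠ v)

/-- Linear abelian type: `T` is a line on which `G` acts by translations (every element acts
either trivially or freely). -/
def LinearAbelian : Prop :=
  T.IsLine ∧ ∀ g : G, (∀ v : T.V, T.act g v = v) ∨ (∀ v : T.V, T.act g v ≠ v)

/-- Dihedral type: `T` is a line and some element acts as a reflection. -/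
def Dihedral : Prop :=
  T.IsLine ∧ ∃ g : G, (∃ v : T.V, T.act g v = v) ∧ (∃ w : T.V, T.act g w ≠ w)

/-- Genuine abelian type: `G` fixes an end and `T` is not a line. -/
def GenuineAbelian : Prop := T.FixesEnd ∧ ¬T.IsLine

/-- Irreducibility, via the characterization by hyperbolicity of a commutator. -/
def Irred : Prop :=
  ∃ g h : G, T.Hyperbolic g ∧ T.Hyperbolic h ∧ T.Hyperbolic (g * h * g⁻¹ * h⁻¹)

/-- The image of a dart (oriented edge) under the action of `g`. -/
def dartAct (g : G) (d : T.graph.Dart) : T.graph.Dart :=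
  ⟨(T.act g d.toProd.1, T.act g d.toProd.2), T.adj_act g d.toProd.1 d.toProd.2 d.adj⟩

/-- Three oriented edges are aligned (in this order) if some geodesic crosses them
successively, with the correct orientations. -/
def Aligned (d₁ d₂ d₃ : T.graph.Dart) : Prop :=
  ∃ (u v : T.V) (p : T.graph.Walk u v), p.IsPath ∧ [d₁, d₂, d₃].Sublist p.darts

end GTree

/-- Two `G`-trees lie in the same deformation space iff they have the same elliptic
subgroups. -/
def SameDef (T T' : GTree G) : Prop := ∀ H : Subgroup G, T.Elliptic H ↔ T'.Elliptic H

/-- An equivariant isomorphism of simplicial `G`-trees. -/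
def SimpIso (T T' : GTree G) : Prop :=
  ∃ e : T.V ≃ T'.V, (∀ (g : G) (v : T.V), e (T.act g v) = T'.act g (e v)) ∧
    ∀ u v : T.V, T.graph.Adj u v ↔ T'.graph.Adj (e u) (e v)

end Trees
section Collapses

variable {G : Type u} [Group G]

/-- Two ordered pairs of adjacent vertices span edges in the same `G`-orbit
(as non-oriented edges). -/
def InEdgeOrbit (T : GTree G) (a b c d : T.V) : Prop :=
  ∃ g : G, (T.act g a = c ∧ T.act g b = d) ∨ (T.act g a = d ∧ T.act g b = c)

/-- `c` exhibits `T'` as a (possibly non-elementary) collapse of `T`: it is equivariant,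
surjective, sends non-collapsed edges to edges, is onto the edges of `T'`, and its point
preimages are subtrees. -/
def IsCollapseMap (T T' : GTree G) (c : T.V → T'.V) : Prop :=
  (∀ (g : G) (v : T.V), c (T.act g v) = T'.act g (c v)) ∧
  Function.Surjective c ∧
  (∀ u v : T.V, T.graph.Adj u v → c u ≠ c v → T'.graph.Adj (c u) (c v)) ∧
  (∀ u' v' : T'.V, T'.graph.Adj u' v' → ∃ u v : T.V, T.graph.Adj u v ∧ c u = u' ∧ c v = v') ∧
  (∀ u v : T.V, c u = c v → ∀ p : T.graph.Walk u v, p.IsPath → ∀ w ∈ p.support, c w = c u)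

/-- `T'` is obtained from `T` by a (possibly non-elementary) collapse. -/
def CollapseOf (T' T : GTree G) : Prop := ∃ c : T.V → T'.V, IsCollapseMap T T' c

/-- `T'` is obtained from `T` by collapsing (exactly) all the edges in the orbit of a
single edge. -/
def IsOrbitCollapse (T' T : GTree G) : Prop :=
  ∃ (c : T.V → T'.V) (u₀ v₀ : T.V), T.graph.Adj u₀ v₀ ∧ IsCollapseMap T T' c ∧
    ∀ u v : T.V, T.graph.Adj u v → (c u = c v ↔ InEdgeOrbit T u v u₀ v₀)

/-- An elementary collapse: collapsing the orbit of a collapsible edge, i.e. an orbit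
collapse staying in the same deformation space. -/
def ElemCollapse (T T' : GTree G) : Prop := IsOrbitCollapse T' T ∧ SameDef T T'

/-- An elementary move: an elementary collapse or an elementary expansion. -/
def ElemMove (T T' : GTree G) : Prop := ElemCollapse T T' ∨ ElemCollapse T' T

/-- An elementary deformation: a finite sequence of elementary collapses and expansions. -/
def ElemDeformation (T T' : GTree G) : Prop := Relation.ReflTransGen ElemMove T T'

/-- A slide move: an edge `f = vx` with `G_f ≤ G_e` slides across `e = vw` (and
equivariantly so does its orbit), becoming an edge `f' = wx`. -/
def SlideMove (T T' : GTree G) : Prop :=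
  ∃ (e : T.V ≃ T'.V) (v w x : T.V),
    T.graph.Adj v w ∧ T.graph.Adj v x ∧ w ≠ x ∧
    T.edgeStab v x ≤ T.edgeStab v w ∧
    ¬InEdgeOrbit T v w v x ∧
    (∀ (g : G) (u : T.V), e (T.act g u) = T'.act g (e u)) ∧
    (∀ a b : T.V, T'.graph.Adj (e a) (e b) ↔
      ((T.graph.Adj a b ∧ ¬InEdgeOrbit T a b v x) ∨ InEdgeOrbit T a b w x))

end Collapses

section MetricTrees

variable (G : Type u) [Group G]

/-- A metric `G`-tree: a simplicial `G`-tree together with an equivariant assignment of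
positive lengths to the edges. -/
structure MGTree extends GTree G : Type (u + 1) where
  len : V → V → ℝ
  len_symm : ∀ u v : V, len u v = len v u
  len_pos : ∀ u v : V, graph.Adj u v → 0 < len u v
  len_equivariant : ∀ (g : G) (u v : V), len (act g u) (act g v) = len u v

variable {G}

namespace MGTree

variable (T : MGTree G)

/-- The length of a walk. -/
noncomputable def walkLen {u v : T.V} (p : T.graph.Walk u v) : ℝ :=
  (p.darts.map fun d => T.len d.toProd.1 d.toProd.2).sum

/-- The distance between two vertices: the length of the unique reduced path joining them. -/
noncomputable def dist (u v : T.V) : ℝ :=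
  sInf {x : ℝ | ∃ p : T.graph.Walk u v, p.IsPath ∧ x = T.walkLen p}

/-- The translation length of `g`. -/
noncomputable def ell (g : G) : ℝ :=
  sInf {x : ℝ | ∃ v : T.V, x = T.dist v (T.act g v)}

/-- The axis (or characteristic set) of `g`: the set of points moved exactly `ℓ(g)`. -/
def Axis (g : G) : Set T.V := {v : T.V | T.dist v (T.act g v) = T.ell g}

/-- `T` is abelian: its length function is the absolute value of a homomorphism to `ℝ`
with cyclic image. -/
def IsAbelian : Prop :=
  ∃ φ : G → ℝ, (∀ g h : G, φ (g * h) = φ g + φ h) ∧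
    (∃ a : ℝ, ∀ g : G, ∃ n : ℤ, φ g = (n : ℝ) * a) ∧
    ∀ g : G, T.ell g = |φ g|

/-- Irreducibility for metric trees: two hyperbolic elements with disjoint axes. -/
def Irr : Prop :=
  ∃ g h : G, T.toGTree.Hyperbolic g ∧ T.toGTree.Hyperbolic h ∧ T.Axis g ∩ T.Axis h = ∅

end MGTree

/-- An equivariant simplicial isomorphism multiplying all edge lengths by `c`. -/
def EquivHomothety (c : ℝ) (T T' : MGTree G) : Prop :=
  ∃ e : T.V ≃ T'.V, (∀ (g : G) (v : T.V), e (T.act g v) = T'.act g (e v)) ∧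
    (∀ u v : T.V, T.graph.Adj u v ↔ T'.graph.Adj (e u) (e v)) ∧
    ∀ u v : T.V, T.graph.Adj u v → T'.len (e u) (e v) = c * T.len u v

/-- An equivariant isometry of metric `G`-trees. -/
def EquivIsometric (T T' : MGTree G) : Prop := EquivHomothety 1 T T'

/-- The action of an automorphism of `G` on metric `G`-trees, by precomposition. -/
def MGTree.precomp (φ : MulAut G) (T : MGTree G) : MGTree G where
  V := T.V
  nonempty := T.nonempty
  graph := T.graph
  isTree := T.isTree
  act := T.act.comp φ.toMonoidHom
  adj_act := fun g u v h => T.adj_act (φ g) u v h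
  noInversion := fun g u v h => T.noInversion (φ g) u v h
  minimal := fun S h1 h2 h3 => T.minimal S h1
    (fun g v hv => by simpa using h2 (φ.symm g) v hv) h3
  len := T.len
  len_symm := T.len_symm
  len_pos := T.len_pos
  len_equivariant := fun g u v => T.len_equivariant (φ g) u v

end MetricTrees
section Topologies

variable (G : Type u) [Group G]

/-- Basic Gromov–Hausdorff neighbourhood of the metric `G`-tree `T` determined by finite
sets `X ⊆ T`, `A ⊆ G` and `ε > 0`: the trees admitting an `ε`-approximate equivariant
lift of `X`. -/
def gromovBasic (T : MGTree G) (X : Finset T.V) (A : Finset G) (ε : ℝ) : Set (MGTree G) :=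
  {T' : MGTree G | ∃ f : T.V → T'.V, ∀ x ∈ X, ∀ y ∈ X, ∀ g ∈ A,
    |T.dist x (T.act g y) - T'.dist (f x) (T'.act g (f y))| < ε}

/-- The equivariant Gromov–Hausdorff topology on the space of metric `G`-trees. -/
noncomputable def gromovTop : TopologicalSpace (MGTree G) where
  IsOpen U := ∀ T ∈ U, ∃ (X : Finset T.V) (A : Finset G) (ε : ℝ), 0 < ε ∧
    gromovBasic G T X A ε ⊆ U
  isOpen_univ := fun T _ => ⟨∅, ∅, 1, one_pos, Set.subset_univ _⟩
  isOpen_inter := by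
    intro U V hU hV T hT
    obtain ⟨X₁, A₁, ε₁, hε₁, h₁⟩ := hU T hT.1
    obtain ⟨X₂, A₂, ε₂, hε₂, h₂⟩ := hV T hT.2
    refine ⟨X₁ ∪ X₂, A₁ ∪ A₂, min ε₁ ε₂, lt_min hε₁ hε₂, ?_⟩
    intro T' hT'
    obtain ⟨f, hf⟩ := hT'
    constructor
    · exact h₁ ⟨f, fun x hx y hy g hg =>
        lt_of_lt_of_le (hf x (Finset.mem_union_left _ hx) y (Finset.mem_union_left _ hy) g
          (Finset.mem_union_left _ hg)) (min_le_left _ _)⟩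
    · exact h₂ ⟨f, fun x hx y hy g hg =>
        lt_of_lt_of_le (hf x (Finset.mem_union_right _ hx) y (Finset.mem_union_right _ hy) g
          (Finset.mem_union_right _ hg)) (min_le_right _ _)⟩
  isOpen_sUnion := by
    intro s hs T hT
    obtain ⟨U, hUs, hTU⟩ := hT
    obtain ⟨X, A, ε, hε, h⟩ := hs U hUs T hTU
    exact ⟨X, A, ε, hε, h.trans (Set.subset_sUnion_of_mem hUs)⟩

variable {G}

/-- The closed cone of the (restricted) deformation space `D` spanned by `T`: the trees
of `D` obtained from trees having the same underlying simplicial tree as `T` by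
(elementary) collapses. -/
def closedCone (D : Set (MGTree G)) (T : MGTree G) : Set (MGTree G) :=
  {T' : MGTree G | T' ∈ D ∧ CollapseOf T'.toGTree T.toGTree}

/-- The open cone containing `T`: the trees with the same underlying simplicial tree. -/
def openCone (D : Set (MGTree G)) (T : MGTree G) : Set (MGTree G) :=
  {T' : MGTree G | T' ∈ D ∧ SimpIso T'.toGTree T.toGTree}

variable (G)

/-- The weak topology on a deformation space `D`: a set is closed if and only if its
intersection with every closed cone of `D` is closed (each closed cone carrying the
Gromov topology). -/
noncomputable def weakTop (D : Set (MGTree G)) : TopologicalSpace ↥D :=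
  ⨆ (T : MGTree G) (_ : T ∈ D), TopologicalSpace.coinduced
    (fun x : {S : MGTree G // S ∈ closedCone D T} => (⟨x.1, x.2.1⟩ : ↥D))
    (TopologicalSpace.induced (fun x : {S : MGTree G // S ∈ closedCone D T} => x.1)
      (gromovTop G))

variable {G}

/-- The projectivizing relation on a deformation space: agreement up to rescaling, i.e.
equivariant homothety. -/
def projRel (D : Set (MGTree G)) (a b : ↥D) : Prop :=
  ∃ c : ℝ, 0 < c ∧ EquivHomothety c a.1 b.1

/-- The relation of equivariant isometry on a deformation space. -/
def isomRel (D : Set (MGTree G)) (a b : ↥D) : Prop := EquivIsometric a.1 b.1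

end Topologies

section Morphisms

variable {G : Type u} [Group G]

/-- A morphism of simplicial `G`-trees: an equivariant map sending each edge onto a
non-degenerate edge path (obtained by subdividing the edge into finitely many subsegments,
each mapped bijectively onto an edge). -/
structure GMorphism (T T' : GTree G) where
  f : T.V → T'.V
  equivariant : ∀ (g : G) (v : T.V), f (T.act g v) = T'.act g (f v)
  edgeWalk : ∀ u v : T.V, T.graph.Adj u v → T'.graph.Walk (f u) (f v)
  edgeWalk_ne_nil : ∀ (u v : T.V) (h : T.graph.Adj u v), ¬(edgeWalk u v h).Nil
  edgeWalk_symm : ∀ (u v : T.V) (h : T.graph.Adj u v),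
    (edgeWalk v u h.symm).support = (edgeWalk u v h).support.reverse
  edgeWalk_equivariant : ∀ (g : G) (u v : T.V) (h : T.graph.Adj u v),
    (edgeWalk (T.act g u) (T.act g v) (T.adj_act g u v h)).support =
      (edgeWalk u v h).support.map (fun x => T'.act g x)

/-- `H` is bi-elliptic in `T`: it fixes two distinct points. -/
def BiElliptic (T : GTree G) (H : Subgroup G) : Prop :=
  ∃ u v : T.V, u ≠ v ∧ ∀ h ∈ H, T.act h u = u ∧ T.act h v = v

/-- `H` is a generalized edge group of `T`: it is squeezed between two edge stabilizers. -/
def GenEdgeGroup (T : GTree G) (H : Subgroup G) : Prop :=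
  ∃ u v u' v' : T.V, T.graph.Adj u v ∧ T.graph.Adj u' v' ∧
    T.edgeStab u v ≤ H ∧ H ≤ T.edgeStab u' v'

/-- `H` belongs to `𝒜_min` (relative to the deformation space of `T₀`): it fixes an edge
in every tree of the deformation space. -/
def Amin (T₀ : GTree G) (H : Subgroup G) : Prop :=
  ∀ T : GTree G, SameDef T₀ T → ∃ u v : T.V, T.graph.Adj u v ∧ H ≤ T.edgeStab u v

/-- A maximal elliptic subgroup (of the deformation space of `T₀`). -/
def MaxElliptic (T₀ : GTree G) (H : Subgroup G) : Prop :=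
  T₀.Elliptic H ∧ ∀ K : Subgroup G, T₀.Elliptic K → H ≤ K → K = H

end Morphisms

section OutG

variable (G : Type u) [Group G]

instance innRange_normal : ((MulAut.conj : G →* MulAut G).range).Normal := by
  constructor
  intro a ha φ
  obtain ⟨g, rfl⟩ := ha
  refine ⟨φ g, ?_⟩
  ext x
  simp only [MulAut.mul_apply, MulAut.conj_apply, map_mul, map_inv]
  simp [MulAut.inv_def]

/-- The outer automorphism group of `G`. -/
def OutG := MulAut G ⧸ (MulAut.conj : G →* MulAut G).range

noncomputable instance : Group (OutG G) := QuotientGroup.Quotient.group _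

/-- The class of an automorphism in `Out(G)`. -/
def toOutG (φ : MulAut G) : OutG G := QuotientGroup.mk φ

end OutG
section RealTrees

variable (G : Type u) [Group G]

/-- A non-trivial minimal `ℝ`-tree with an isometric action of `G`: a geodesic metric
space in which any two points are joined by a unique arc. -/
structure RGTree : Type (u + 1) where
  X : Type u
  [ms : MetricSpace X]
  nontrivial : Nontrivial X
  geodesic : ∀ x y : X, ∃ f : ℝ → X, f 0 = x ∧ f (dist x y) = y ∧
    ∀ s ∈ Set.Icc (0 : ℝ) (dist x y), ∀ t ∈ Set.Icc (0 : ℝ) (dist x y),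
      dist (f s) (f t) = |s - t|
  unique_arc : ∀ (x y : X) (γ : Set.Icc (0 : ℝ) 1 → X), Continuous γ →
    Function.Injective γ → γ ⟨0, by constructor <;> norm_num⟩ = x →
    γ ⟨1, by constructor <;> norm_num⟩ = y →
    ∀ z ∈ Set.range γ, dist x z + dist z y = dist x y
  act : G →* Equiv.Perm X
  isom : ∀ g : G, Isometry (act g)
  minimal : ∀ S : Set X, S.Nonempty → (∀ (g : G), ∀ x ∈ S, act g x ∈ S) →
    (∀ x ∈ S, ∀ y ∈ S, ∀ z : X, dist x z + dist z y = dist x y → z ∈ S) →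
    S = Set.univ

attribute [instance] RGTree.ms

variable {G}

namespace RGTree

variable (R : RGTree G)

/-- `z` lies between `x` and `y` (i.e. on the arc from `x` to `y`). -/
def Btw (x z y : R.X) : Prop := dist x z + dist z y = dist x y

/-- A subgroup is elliptic if it fixes a point. -/
def Elliptic (H : Subgroup G) : Prop := ∃ x : R.X, ∀ h ∈ H, R.act h x = x

/-- A hyperbolic element fixes no point. -/
def Hyperbolic (g : G) : Prop := ∀ x : R.X, R.act g x ≠ x

/-- The translation length of `g`. -/
noncomputable def ell (g : G) : ℝ :=
  sInf {r : ℝ | ∃ x : R.X, r = dist x (R.act g x)}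

/-- The characteristic set of `g`: its axis if `g` is hyperbolic, its fixed point set
if `g` is elliptic. -/
def Axis (g : G) : Set R.X := {x : R.X | dist x (R.act g x) = R.ell g}

/-- The fixed point set of `g`. -/
def Fix (g : G) : Set R.X := {x : R.X | R.act g x = x}

/-- The fixed point set of a subgroup. -/
def FixSub (H : Subgroup G) : Set R.X := {x : R.X | ∀ h ∈ H, R.act h x = x}

/-- Irreducibility: two hyperbolic elements with disjoint characteristic sets. -/
def Irr : Prop :=
  ∃ g h : G, R.Hyperbolic g ∧ R.Hyperbolic h ∧ R.Axis g ∩ R.Axis h = ∅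

/-- The distance between the characteristic sets of `g` and `h`. -/
noncomputable def axesDist (g h : G) : ℝ :=
  sInf {r : ℝ | ∃ x ∈ R.Axis g, ∃ y ∈ R.Axis h, r = dist x y}

end RGTree

/-- `f` realizes the metric simplicial `G`-tree `T` inside the `ℝ`-tree `R`. -/
def IsRealizationMap (R : RGTree G) (T : MGTree G) (f : T.V → R.X) : Prop :=
  (∀ (g : G) (v : T.V), f (T.act g v) = R.act g (f v)) ∧
  (∀ u v : T.V, dist (f u) (f v) = T.dist u v) ∧
  ∀ x : R.X, ∃ u v : T.V, T.graph.Adj u v ∧ R.Btw (f u) x (f v)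

/-- The `ℝ`-tree `R` is (equivariantly isometric to) the geometric realization of the
metric simplicial `G`-tree `T`. -/
def RealizationOf (R : RGTree G) (T : MGTree G) : Prop := ∃ f : T.V → R.X, IsRealizationMap R T f

variable (G)

/-- The equivariant Gromov–Hausdorff topology on the space of `ℝ`-trees. -/
noncomputable def gromovTopR : TopologicalSpace (RGTree G) where
  IsOpen U := ∀ R ∈ U, ∃ (X : Finset R.X) (A : Finset G) (ε : ℝ), 0 < ε ∧
    {R' : RGTree G | ∃ f : R.X → R'.X, ∀ x ∈ X, ∀ y ∈ X, ∀ g ∈ A,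
      |dist x (R.act g y) - dist (f x) (R'.act g (f y))| < ε} ⊆ U
  isOpen_univ := fun R _ => ⟨∅, ∅, 1, one_pos, Set.subset_univ _⟩
  isOpen_inter := by
    intro U V hU hV R hR
    obtain ⟨X₁, A₁, ε₁, hε₁, h₁⟩ := hU R hR.1
    obtain ⟨X₂, A₂, ε₂, hε₂, h₂⟩ := hV R hR.2
    refine ⟨X₁ ∪ X₂, A₁ ∪ A₂, min ε₁ ε₂, lt_min hε₁ hε₂, ?_⟩
    rintro R' ⟨f, hf⟩
    constructor
    · exact h₁ ⟨f, fun x hx y hy g hg =>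
        lt_of_lt_of_le (hf x (Finset.mem_union_left _ hx) y (Finset.mem_union_left _ hy) g
          (Finset.mem_union_left _ hg)) (min_le_left _ _)⟩
    · exact h₂ ⟨f, fun x hx y hy g hg =>
        lt_of_lt_of_le (hf x (Finset.mem_union_right _ hx) y (Finset.mem_union_right _ hy) g
          (Finset.mem_union_right _ hg)) (min_le_right _ _)⟩
  isOpen_sUnion := by
    intro s hs R hR
    obtain ⟨U, hUs, hRU⟩ := hR
    obtain ⟨X, A, ε, hε, h⟩ := hs U hUs R hRU
    exact ⟨X, A, ε, hε, h.trans (Set.subset_sUnion_of_mem hUs)⟩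

/-- The axes topology: the coarsest topology making all translation length functions
continuous. -/
noncomputable def axesTopR : TopologicalSpace (RGTree G) :=
  TopologicalSpace.induced (fun (R : RGTree G) (g : G) => R.ell g) Pi.topologicalSpace

variable {G}

/-- A morphism of `ℝ`-trees: an equivariant map such that every segment is a finite union
of subsegments on each of which the map is isometric. -/
structure RMorphism (R S : RGTree G) where
  f : R.X → S.X
  equivariant : ∀ (g : G) (x : R.X), f (R.act g x) = S.act g (f x)
  piecewise : ∀ x y : R.X, ∃ (n : ℕ) (c : Fin (n + 1) → R.X),
    c 0 = x ∧ c (Fin.last n) = y ∧ (∀ i : Fin (n + 1), R.Btw x (c i) y) ∧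
    ∀ i : Fin n, ∀ p q : R.X, R.Btw (c i.castSucc) p (c i.succ) →
      R.Btw (c i.castSucc) q (c i.succ) → dist (f p) (f q) = dist p q

/-- `M` is the intermediate tree at time `t` of Skora's deformation of the morphism `φ`:
the quotient of the source in which `x` and `y` are identified exactly when `φ` maps the
segment `[x,y]` into the ball of radius `t` around `φ(x) = φ(y)`. -/
def IsSkoraIntermediate {R S : RGTree G} (φ : RMorphism R S) (t : ℝ) (M : RGTree G) : Prop :=
  ∃ (p : R.X → M.X) (q : M.X → S.X), Function.Surjective p ∧
    (∀ (g : G) (x : R.X), p (R.act g x) = M.act g (p x)) ∧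
    (∀ (g : G) (m : M.X), q (M.act g m) = S.act g (q m)) ∧
    (∀ x : R.X, q (p x) = φ.f x) ∧
    (∀ x y : R.X, dist (p x) (p y) ≤ dist x y) ∧
    (∀ m m' : M.X, dist (q m) (q m') ≤ dist m m') ∧
    ∀ x y : R.X, p x = p y ↔ (φ.f x = φ.f y ∧
      ∀ z : R.X, R.Btw x z y → dist (φ.f z) (φ.f x) ≤ t)

/-- `P` is the basepoint of `R` determined by `g` and `h` (the endpoint of the
intersection of the two characteristic sets, resp. the projection of one onto the other),
characterized by the metric system (1) of [Guirardel–Levitt]. -/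
noncomputable def IsBasepoint (R : RGTree G) (g h : G) (P : R.X) : Prop :=
  dist P (R.act g P) = R.ell g ∧
  dist P (R.act h P) = R.ell h + 2 * R.axesDist g h ∧
  dist (R.act g P) (R.act h P) = R.ell g + R.ell h + 2 * R.axesDist g h ∧
  dist (R.act g P) (R.act h⁻¹ P) = R.ell g + R.ell h + 2 * R.axesDist g h

/-- `p` is a projection of `x` to the set `S` (a closest point of `S`). -/
def IsProj (R : RGTree G) (x : R.X) (S : Set R.X) (p : R.X) : Prop :=
  p ∈ S ∧ ∀ q ∈ S, dist x p ≤ dist x q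

/-- Equivariant isometry of `ℝ`-trees. -/
def RIsom (R R' : RGTree G) : Prop :=
  ∃ e : R.X ≃ R'.X, (∀ (g : G) (x : R.X), e (R.act g x) = R'.act g (e x)) ∧
    ∀ x y : R.X, dist (e x) (e y) = dist x y

/-- Equivariant homothety of `ℝ`-trees, with ratio `c`. -/
def RHomothety (c : ℝ) (R R' : RGTree G) : Prop :=
  ∃ e : R.X ≃ R'.X, (∀ (g : G) (x : R.X), e (R.act g x) = R'.act g (e x)) ∧
    ∀ x y : R.X, dist (e x) (e y) = c * dist x y

end RealTrees
section MoreDefs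

variable {G : Type u} [Group G]

/-- `H` is contained in a conjugate of `K`. -/
def ConjLe (H K : Subgroup G) : Prop := ∃ g : G, ∀ h ∈ H, g * h * g⁻¹ ∈ K

/-- `H` represents a maximal element of the vertical set `ℳ` associated to the
deformation space of `T₀`. -/
def MaxVert (T₀ : GTree G) (H : Subgroup G) : Prop :=
  T₀.Elliptic H ∧ ∀ K : Subgroup G, T₀.Elliptic K → ConjLe H K → ConjLe K H

/-- The vertical set `ℳ`: equivalence classes of maximal elements for containment in a
conjugate, among elliptic subgroups. -/
def vertSet (T₀ : GTree G) : Type u :=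
  Quot (fun H K : {H : Subgroup G // MaxVert T₀ H} => ConjLe H.1 K.1 ∧ ConjLe K.1 H.1)

namespace GTree

variable (T : GTree G)

/-- The set of `G`-orbits of vertices (the vertices of the quotient graph `T/G`). -/
def vertexOrbits : Type u := Quot (fun u v : T.V => ∃ g : G, T.act g u = v)

/-- Orbits of neighbours of `v` under the stabilizer of `v`: the oriented edges of the
quotient graph of groups issued from the image of `v`, whose number is the valence of
the image of `v`. -/
def nbrOrbits (v : T.V) : Type u :=
  Quot (fun a b : {w : T.V // T.graph.Adj v w} => ∃ g : G, T.act g v = v ∧ T.act g a.1 = b.1)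

/-- The set of `G`-orbits of (non-oriented) edges. -/
def edgeOrbits : Type u :=
  Quot (fun d d' : T.graph.Dart => ∃ g : G, T.dartAct g d = d' ∨ T.dartAct g d = d'.symm)

/-- BF-reduced: if an edge-to-vertex inclusion `G_e → G_u` is onto, then the image of `u`
in the quotient graph has valence at least 3. -/
def BFReduced : Prop :=
  ∀ u w : T.V, T.graph.Adj u w → T.stab u ≤ T.stab w →
    3 ≤ Cardinal.mk (T.nbrOrbits u)

end GTree

/-- The quotient graph of groups of `T` has a strict ascending loop: an edge whose
endpoints are in the same orbit, exactly one of the two edge-to-vertex inclusions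
being onto. -/
def HasSAL (T : GTree G) : Prop :=
  ∃ u v : T.V, T.graph.Adj u v ∧ (∃ g : G, T.act g u = v) ∧
    Xor' (T.stab u ≤ T.stab v) (T.stab v ≤ T.stab u)

/-- The edge (orbit of) `uv` is a surviving edge: `T` can be made reduced by a collapse
(within its deformation space) not collapsing `uv`. -/
def Surviving (T : GTree G) (u v : T.V) : Prop :=
  ∃ (T' : GTree G) (c : T.V → T'.V), IsCollapseMap T T' c ∧ SameDef T T' ∧
    T'.Reduced ∧ c u ≠ c v

/-- Containment in a conjugate by an element of `G₀`. -/
def perLe (G₀ : Subgroup G) (H K : Subgroup G) : Prop :=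
  ∃ g ∈ G₀, ∀ h ∈ H, g * h * g⁻¹ ∈ K

/-- `H` represents a maximal element of the peripheral structure `ℳ₀` of `G₀`. -/
def PeriphMax (T₀ : GTree G) (G₀ : Subgroup G) (H : Subgroup G) : Prop :=
  H ≤ G₀ ∧ Amin T₀ H ∧
    ∀ K : Subgroup G, K ≤ G₀ → Amin T₀ K → perLe G₀ H K → perLe G₀ K H

/-- The peripheral structure `ℳ₀` of `G₀`, as a set of equivalence classes. -/
def periphSet (T₀ : GTree G) (G₀ : Subgroup G) : Type u :=
  Quot (fun H K : {H : Subgroup G // PeriphMax T₀ G₀ H} =>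
    perLe G₀ H.1 K.1 ∧ perLe G₀ K.1 H.1)

end MoreDefs


section AbstractTrees

/-- Betweenness in a metric space. -/
def Bt {X : Type u} [MetricSpace X] (x y z : X) : Prop := dist x y + dist y z = dist x z

/-- A zero-hyperbolic metric space with medians. -/
class MTree (X : Type u) [MetricSpace X] : Prop where
  four : ∀ x y z w : X,
    dist x y + dist z w ≤ max (dist x z + dist y w) (dist x w + dist y z)
  med : ∀ x y z : X, ∃ m : X, Bt x m y ∧ Bt y m z ∧ Bt x m z

variable {X : Type u} [MetricSpace X]

theorem Bt.symm {x y z : X} (h : Bt x y z) : Bt z y x := by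
  unfold Bt at *
  rw [dist_comm z y, dist_comm y x, dist_comm z x]; linarith

theorem bt_comm {x y z : X} : Bt x y z ↔ Bt z y x := ⟨Bt.symm, Bt.symm⟩

theorem bt_left (x y : X) : Bt x x y := by simp [Bt]

theorem bt_right (x y : X) : Bt x y y := by simp [Bt]

/-- transitivity -/
theorem Bt.trans1 {x a b c : X} (h1 : Bt x a b) (h2 : Bt x b c) : Bt x a c := by
  unfold Bt at *
  have := dist_triangle x a c
  have := dist_triangle a b c
  linarith

theorem Bt.trans2 {x a b c : X} (h1 : Bt x a b) (h2 : Bt x b c) : Bt a b c := by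
  unfold Bt at *
  have := dist_triangle x a c
  have := dist_triangle a b c
  linarith

variable [MTree X]

theorem four_or (x y z w : X) :
    dist x y + dist z w ≤ dist x z + dist y w ∨ dist x y + dist z w ≤ dist x w + dist y z :=
  le_max_iff.1 (MTree.four x y z w)

theorem Bt.chain {x y z w : X} (h1 : Bt x y z) (h2 : Bt y z w) (hne : y ≠ z) :
    Bt x y w ∧ Bt x z w := by
  unfold Bt at *
  have hp : 0 < dist y z := dist_pos.2 hne
  have t1 := dist_triangle x y w
  have t2 := dist_triangle x z w
  have t3 := dist_comm z y
  rcases four_or x z y w with h | h <;> constructor <;> linarith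

theorem Bt.lin {u v x y : X} (h1 : Bt u x v) (h2 : Bt u y v) (h : dist u x ≤ dist u y) :
    Bt u x y := by
  unfold Bt at *
  have t1 := dist_triangle u x y
  have t3 := dist_comm x u
  have t4 := dist_comm y u
  rcases four_or x y u v with h | h <;> linarith

theorem Bt.eq_of {u v x y : X} (h1 : Bt u x v) (h2 : Bt u y v) (h : dist u x = dist u y) :
    x = y := by
  have := Bt.lin h1 h2 h.le
  unfold Bt at this
  exact dist_le_zero.1 (by linarith)

theorem Bt.tot {u v x y : X} (h1 : Bt u x v) (h2 : Bt u y v) :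
    (Bt u x y ∧ Bt x y v) ∨ (Bt u y x ∧ Bt y x v) := by
  rcases le_total (dist u x) (dist u y) with h | h
  · left
    have := Bt.lin h1 h2 h
    exact ⟨this, this.trans2 h2⟩
  · right
    have := Bt.lin h2 h1 h
    exact ⟨this, this.trans2 h1⟩

theorem Bt.either {a z b : X} (h : Bt a z b) (c : X) : Bt c z a ∨ Bt c z b := by
  unfold Bt at *
  have t3 := dist_comm z a
  have t1 := dist_triangle c z a
  have t2 := dist_triangle c z b
  rcases four_or c z a b with h | h
  · left; linarith
  · right; linarith

variable {G : Type u} [Group G] [MulAction G X] [IsIsometricSMul G X]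

theorem Bt.smul {x y z : X} (h : Bt x y z) (g : G) : Bt (g • x) (g • y) (g • z) := by
  unfold Bt at *; simpa using h

/-- `x` is on the axis of the hyperbolic `g`. -/
def Ax (g : G) (x : X) : Prop := g • x ≠ x ∧ Bt x (g • x) (g • g • x)

theorem dist_inv_smul (g : G) (x y : X) : dist (g⁻¹ • x) y = dist x (g • y) := by
  rw [← dist_smul g (g⁻¹ • x) y, smul_inv_smul]

theorem Ax.pos {g : G} {x : X} (h : Ax g x) : 0 < dist x (g • x) := dist_pos.2 h.1.symm

theorem Ax.pow_aux {g : G} {x : X} (h : Ax g x) (n : ℕ) :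
    dist x (g ^ n • x) = n * dist x (g • x) ∧
      dist x (g ^ (n + 1) • x) = (n + 1) * dist x (g • x) := by
  induction n with
  | zero => simp
  | succ n ih =>
    obtain ⟨h1, h2⟩ := ih
    refine ⟨by push_cast; exact h2, ?_⟩
    have e1 : dist (g ^ n • x) (g ^ (n + 1) • x) = dist x (g • x) := by
      rw [pow_succ, mul_smul, dist_smul]
    have e2 : dist (g ^ (n + 1) • x) (g ^ (n + 1 + 1) • x) = dist x (g • x) := by
      rw [pow_succ g (n + 1), mul_smul, dist_smul]
    have b1 : Bt x (g ^ n • x) (g ^ (n + 1) • x) := by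
      unfold Bt; rw [h1, h2, e1]; ring
    have b2 : Bt (g ^ n • x) (g ^ (n + 1) • x) (g ^ (n + 1 + 1) • x) := by
      have := h.2.smul (g ^ n)
      simpa [pow_succ, mul_smul] using this
    have hne : g ^ n • x ≠ g ^ (n + 1) • x := by
      rw [← dist_pos, e1]; exact h.pos
    have := (b1.chain b2 hne).2
    unfold Bt at this
    rw [← this, h2, e2]; push_cast; ring

theorem Ax.pow {g : G} {x : X} (h : Ax g x) (n : ℕ) :
    dist x (g ^ n • x) = n * dist x (g • x) := (h.pow_aux n).1

theorem Ax.inv {g : G} {x : X} (h : Ax g x) : Ax g⁻¹ x := by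
  refine ⟨fun e => h.1 (by rw [eq_comm, ← inv_smul_eq_iff, e]), ?_⟩
  have := (h.2.smul (g⁻¹ * g⁻¹)).symm
  simpa [mul_smul] using this

theorem dist_inv_smul_self (g : G) (x : X) : dist x (g⁻¹ • x) = dist x (g • x) := by
  rw [dist_comm, dist_inv_smul]

theorem le_of_nat_mul {e L C : ℝ} (h : ∀ n : ℕ, n * e ≤ C + n * L) : e ≤ L := by
  by_contra hc
  push Not at hc
  obtain ⟨n, hn⟩ := exists_nat_gt (C / (e - L))
  rw [div_lt_iff₀ (by linarith)] at hn
  have := h n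
  nlinarith

theorem dist_pow_le (g : G) (x : X) (n : ℕ) : dist x (g ^ n • x) ≤ n * dist x (g • x) := by
  induction n with
  | zero => simp
  | succ n ih =>
    have := dist_triangle x (g ^ n • x) (g ^ (n + 1) • x)
    have e1 : dist (g ^ n • x) (g ^ (n + 1) • x) = dist x (g • x) := by
      rw [pow_succ, mul_smul, dist_smul]
    push_cast; linarith

theorem Ax.le {g : G} {y : X} (h : Ax g y) (x : X) : dist y (g • y) ≤ dist x (g • x) := by
  refine le_of_nat_mul (C := 2 * dist x y) fun n => ?_
  rw [← h.pow n]
  have t1 := dist_triangle y x (g ^ n • y)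
  have t2 := dist_triangle x (g ^ n • x) (g ^ n • y)
  have t3 := dist_smul (g ^ n) x y
  have t4 := dist_pow_le g x n
  have t5 := dist_comm y x
  linarith

theorem Ax.eq {g : G} {x y : X} (hx : Ax g x) (hy : Ax g y) :
    dist x (g • x) = dist y (g • y) := le_antisymm (hx.le y) (hy.le x)

theorem Ax.between {g : G} {x y : X} (hx : Ax g x) (hy : Ax g y) (n : ℕ)
    (hn : dist x y < n * dist y (g • y)) : Bt ((g ^ n)⁻¹ • y) x (g ^ n • y) := by
  have e1 := hx.pow n
  have e2 := hy.pow n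
  rw [hx.eq hy] at e1
  have e3 : dist (g ^ n • x) (g ^ n • y) = dist x y := dist_smul _ _ _
  have e4 : dist ((g ^ n)⁻¹ • y) x = dist y (g ^ n • x) := dist_inv_smul _ _ _
  have e5 : dist ((g ^ n)⁻¹ • y) (g ^ n • y) = 2 * (n * dist y (g • y)) := by
    rw [dist_inv_smul, ← mul_smul, ← pow_add, hy.pow]; push_cast; ring
  unfold Bt
  rw [e4, e5]
  have t0 := dist_comm y (g ^ n • x)
  have t1 := dist_triangle ((g ^ n)⁻¹ • y) x (g ^ n • y)
  rw [e4, e5] at t1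
  have c1 := dist_comm (g ^ n • y) (g ^ n • x)
  have c2 := dist_comm (g ^ n • y) y
  rcases four_or x (g ^ n • y) y (g ^ n • x) with h | h <;> linarith

theorem Ax.exists_n {g : G} {y : X} (hy : Ax g y) (C : ℝ) :
    ∃ n : ℕ, C < n * dist y (g • y) := by
  obtain ⟨n, hn⟩ := exists_nat_gt (C / dist y (g • y))
  rw [div_lt_iff₀ hy.pos] at hn
  exact ⟨n, hn⟩

theorem Ax.collinear {g : G} {a b c : X} (ha : Ax g a) (hb : Ax g b) (hc : Ax g c) :
    Bt a b c ∨ Bt b a c ∨ Bt a c b := by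
  obtain ⟨n, hn⟩ := ha.exists_n (max (dist b a) (dist c a))
  have hb' := hb.between ha n (lt_of_le_of_lt (le_max_left _ _) hn)
  have hc' := hc.between ha n (lt_of_le_of_lt (le_max_right _ _) hn)
  have ha' := ha.between ha n (by
    rw [dist_self]
    exact lt_of_le_of_lt (le_trans dist_nonneg (le_max_left (dist b a) (dist c a))) hn)
  set u := (g ^ n)⁻¹ • a
  set v := g ^ n • a
  rcases le_total (dist u a) (dist u b) with h1 | h1 <;>
    rcases le_total (dist u b) (dist u c) with h2 | h2 <;>
    rcases le_total (dist u a) (dist u c) with h3 | h3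
  · exact Or.inl ((ha'.lin hb' h1).trans2 (hb'.lin hc' h2))
  · exact Or.inl ((ha'.lin hb' h1).trans2 (hb'.lin hc' h2))
  · exact Or.inr (Or.inr ((ha'.lin hc' h3).trans2 (hc'.lin hb' h2)))
  · exact Or.inr (Or.inl ((hc'.lin ha' h3).trans2 (ha'.lin hb' h1)).symm)
  · exact Or.inr (Or.inl ((hb'.lin ha' h1).trans2 (ha'.lin hc' h3)))
  · exact Or.inr (Or.inr ((hb'.lin hc' h2).trans2 (hc'.lin ha' h3)).symm)
  · exact Or.inl ((hc'.lin hb' h2).trans2 (hb'.lin ha' h1)).symm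
  · exact Or.inl ((hc'.lin hb' h2).trans2 (hb'.lin ha' h1)).symm

theorem dichotomy (g : G) (b : X) :
    (∃ p : X, Ax g p ∧ Bt b p (g • p) ∧ Bt b p (g⁻¹ • p) ∧
      dist b (g • b) = dist p (g • p) + 2 * dist b p ∧
      dist b (g • g • b) = 2 * dist p (g • p) + 2 * dist b p) ∨
    (∃ p : X, g • g • p = p ∧ dist b (g • g • b) ≤ dist b (g • b)) := by
  obtain ⟨p, h1, h2, h3⟩ := MTree.med (g⁻¹ • b) b (g • b)
  have s1 : dist (g • p) (g • b) = dist p b := dist_smul _ _ _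
  have s2 : dist (g⁻¹ • b) p = dist b (g • p) := dist_inv_smul _ _ _
  have s3 : dist (g⁻¹ • b) b = dist b (g • b) := dist_inv_smul _ _ _
  have s4 : dist (g⁻¹ • b) (g • b) = dist b (g • g • b) := dist_inv_smul _ _ _
  have s5 := dist_comm p b
  have B1 : Bt b (g • p) (g • b) := by unfold Bt at *; linarith
  rcases lt_or_ge (dist b p) (dist b (g • p)) with h | h
  · left
    have B2 := h2.lin B1 h.le
    have s6 : dist p (g • p) = dist b (g • p) - dist b p := by unfold Bt at *; linarith
    refine ⟨p, ⟨?_, ?_⟩, B2, ?_, ?_, ?_⟩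
    · rw [← dist_pos, dist_comm]; linarith
    · have t1 := dist_triangle4 b p (g • g • p) (g • g • b)
      have t2 : dist (g • g • p) (g • g • b) = dist p b := by simp
      have t3 : dist (g • p) (g • g • p) = dist p (g • p) := dist_smul _ _ _
      have t4 := dist_triangle p (g • p) (g • g • p)
      unfold Bt at *; linarith
    · have t1 : dist b (g⁻¹ • p) = dist (g • b) p := by rw [dist_comm, dist_inv_smul, dist_comm]
      have t2 := dist_inv_smul_self g p
      have t3 := dist_comm p (g • b)
      unfold Bt at *; linarith
    · unfold Bt at *; linarith
    · unfold Bt at *; linarith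
  · right
    have B2 := B1.lin h2 h
    refine ⟨p, ?_, by unfold Bt at *; linarith⟩
    have t0 : dist (g • g • p) (g • b) = dist (g • p) b := dist_smul _ _ _
    have t1 : dist (g • p) (g • g • p) = dist p (g • p) := dist_smul _ _ _
    have t2 := dist_comm p (g • p)
    have t3 := dist_comm (g • p) b
    apply Bt.eq_of (u := g • p) (v := g • b)
    · unfold Bt at *; linarith
    · unfold Bt at *; linarith
    · linarith

theorem Ax.not_sq {g : G} {y : X} (hy : Ax g y) (p : X) : g • g • p ≠ p := by
  intro hp
  have h2 : ∀ n : ℕ, (g ^ (2 * n)) • p = p := by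
    intro n
    induction n with
    | zero => simp
    | succ n ih =>
      have : g ^ (2 * (n + 1)) = g ^ (2 * n) * (g * g) := by rw [← pow_two, ← pow_add]; ring_nf
      rw [this, mul_smul, mul_smul, hp, ih]
  obtain ⟨n, hn⟩ := hy.exists_n (2 * dist y p)
  have t1 := dist_triangle y p (g ^ (2 * n) • y)
  have t2 : dist p (g ^ (2 * n) • y) = dist p y := by
    conv_lhs => rw [← h2 n]
    rw [dist_smul]
  have t3 := hy.pow (2 * n)
  push_cast at t3
  have := hy.pos
  have := dist_comm p y
  have : (0:ℝ) ≤ n := Nat.cast_nonneg n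
  nlinarith

theorem Ax.not_fix {g : G} {y : X} (hy : Ax g y) (p : X) : g • p ≠ p := by
  intro h
  exact hy.not_sq p (by rw [h, h])

theorem fix_le {g : G} {w : X} (hw : g • w = w) (b : X) :
    dist b (g • g • b) ≤ dist b (g • b) := by
  have t1 : dist (g • b) w = dist b w := by
    conv_lhs => rw [← hw]
    rw [dist_smul]
  have t2 : dist (g • g • b) w = dist (g • b) w := by
    conv_lhs => rw [← hw]
    rw [dist_smul]
  have t3 : dist (g • b) (g • g • b) = dist b (g • b) := dist_smul _ _ _
  have t4 := dist_comm (g • g • b) (g • b)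
  rcases four_or b (g • g • b) (g • b) w with h | h <;> linarith

/-- Projection of a point to an axis. -/
theorem Ax.proj {g : G} {y : X} (hy : Ax g y) (b : X) :
    ∃ p : X, Ax g p ∧ (∀ a, Ax g a → Bt b p a) ∧
      dist b (g • b) = dist p (g • p) + 2 * dist b p ∧
      dist b (g • g • b) = 2 * dist p (g • p) + 2 * dist b p := by
  rcases dichotomy g b with ⟨p, hp, h1, h2, h3, h4⟩ | ⟨p, hp, -⟩
  swap
  · exact absurd hp (hy.not_sq p)
  refine ⟨p, hp, ?_, h3, h4⟩
  have key : ∀ (k : G) (n : ℕ), Ax k p → Bt b p (k • p) → Bt b p (k ^ n • p) := by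
    intro k n hk hb
    rcases n with _ | n
    · simpa using bt_right b p
    · refine (Bt.chain hb ?_ hk.1.symm).1
      unfold Bt
      have : dist (k • p) (k ^ (n + 1) • p) = dist p (k ^ n • p) := by
        rw [pow_succ', mul_smul, dist_smul]
      rw [this, hk.pow, hk.pow]; push_cast; ring
  intro a ha
  obtain ⟨n, hn⟩ := hp.exists_n (dist a p)
  have A := ha.between hp n hn
  have P := hp.between hp n (by rw [dist_self]; exact lt_of_le_of_lt dist_nonneg hn)
  have U := key g⁻¹ n hp.inv h2
  have V := key g n hp h1
  rw [inv_pow] at U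
  rcases P.tot A with ⟨_, h⟩ | ⟨h, _⟩
  · have := dist_triangle b a (g ^ n • p)
    have := dist_triangle b p a
    unfold Bt at *; linarith
  · have := dist_triangle b a ((g ^ n)⁻¹ • p)
    have := dist_triangle b p a
    have h := h.symm
    unfold Bt at *; linarith

theorem Ax.convex_disp {g : G} {x y z : X} {e : ℝ} (hx : dist x (g • x) ≤ e)
    (hy : dist y (g • y) ≤ e) (hz : Bt x z y) : dist z (g • z) ≤ e := by
  have hgz := hz.smul g
  have t3 : dist (g • x) (g • z) = dist x z := dist_smul _ _ _
  have t4 : dist (g • z) (g • y) = dist z y := dist_smul _ _ _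
  have t5 := dist_triangle x y (g • y)
  have t6 := dist_triangle y x (g • x)
  have t7 := dist_comm x y
  have t8 := dist_comm x z
  have t9 := dist_comm (g • z) (g • x)
  have c1 := dist_comm z (g • z)
  have c2 := dist_comm x (g • z)
  have c3 := dist_comm y (g • z)
  rcases hz.either (g • z) with h | h
  · rcases hgz.either x with h' | h' <;> unfold Bt at * <;> linarith [@dist_nonneg X _ x z, @dist_nonneg X _ z y]
  · have c4 := dist_comm z y
    rcases hgz.either y with h' | h' <;> unfold Bt at * <;> linarith [@dist_nonneg X _ x z, @dist_nonneg X _ z y]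

theorem Ax.of_le {g : G} {x y : X} (hy : Ax g y) (h : dist x (g • x) ≤ dist y (g • y)) :
    Ax g x := by
  obtain ⟨p, hp, -, h3, -⟩ := hy.proj x
  have := hp.eq hy
  have : x = p := dist_le_zero.1 (by linarith)
  rwa [this]

theorem Ax.convex {g : G} {x y z : X} (hx : Ax g x) (hy : Ax g y) (hz : Bt x z y) : Ax g z :=
  hx.of_le (Ax.convex_disp le_rfl (hy.eq hx).le hz)

theorem Ax.smul {g : G} {x : X} (hx : Ax g x) (k : G) : Ax (k * g * k⁻¹) (k • x) := by
  refine ⟨?_, ?_⟩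
  · simpa [mul_smul] using hx.1
  · simpa [mul_smul] using hx.2.smul k

theorem Ax.of_conj {g k : G} {x : X} (hx : Ax (k * g * k⁻¹) x) : Ax g (k⁻¹ • x) := by
  have := hx.smul k⁻¹
  simpa [mul_assoc] using this

/-- The bridge between two disjoint axes. -/
structure Bridge (g h : G) (p q : X) : Prop where
  hg : Ax g p
  hh : Ax h q
  ne : p ≠ q
  a1 : Bt (g • p) p q
  a2 : Bt (g⁻¹ • p) p q
  b1 : Bt p q (h • q)
  b2 : Bt p q (h⁻¹ • q)

theorem Ax.smul_self {g : G} {x : X} (hx : Ax g x) : Ax g (g • x) := by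
  have := hx.smul g
  simpa using this

theorem Ax.exists_bridge {g h : G} {a b : X} (ha : Ax g a) (hb : Ax h b)
    (hno : ∀ x : X, Ax g x → ¬ Ax h x) : ∃ p q : X, Bridge g h p q := by
  obtain ⟨p, hp, hp1, -, -⟩ := ha.proj b
  obtain ⟨q, hq, hq1, -, -⟩ := hb.proj p
  have hb' := hq1 b hb
  have hpi : Ax g (g⁻¹ • p) := by simpa using hp.inv.smul_self.inv
  have hqi : Ax h (h⁻¹ • q) := by simpa using hq.inv.smul_self.inv
  refine ⟨p, q, hp, hq, fun e => hno p hp (e ▸ hq), ?_, ?_, hq1 _ hq.smul_self, hq1 _ hqi⟩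
  · exact (hb'.symm.trans2 (hp1 _ hp.smul_self)).symm
  · exact (hb'.symm.trans2 (hp1 _ hpi)).symm

theorem Bridge.conj {g k : G} {p q : X} (h : Bridge g k p q) :
    Bridge g (k * g * k⁻¹) p (k • p) := by
  have hkq : q ≠ k • q := h.hh.1.symm
  have c1 : Bt q (k • q) (k • p) := by
    have := (h.b2.smul k).symm
    simpa using this
  have c2 := h.b1.chain c1 hkq
  -- Bt p q kp, Bt p kq kp
  have hpos : 0 < dist p q := dist_pos.2 h.ne
  have hne : p ≠ k • p := by
    rw [← dist_pos]
    have := c2.1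
    have h0 := @dist_nonneg X _ q (k • p)
    unfold Bt at this; linarith
  have hkne : k • q ≠ k • p := fun e => h.ne (smul_left_cancel k e).symm
  refine ⟨h.hg, h.hg.smul k, hne, (h.a1.chain c2.1 h.ne).1, (h.a2.chain c2.1 h.ne).1, ?_, ?_⟩
  · have := (h.a1.smul k).symm
    have := (c2.2.chain this hkne).2
    simpa [mul_smul] using this
  · have := (h.a2.smul k).symm
    have := (c2.2.chain this hkne).2
    simpa [mul_smul] using this

theorem Bridge.comm {x y : G} {p q : X} (h : Bridge x y p q) :
    Ax (x * y * x⁻¹ * y⁻¹) p ∧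
      dist p (x • p) ≤ dist p ((x * y * x⁻¹ * y⁻¹) • p) := by
  have n1 : ∀ k : G, k • p ≠ k • q := fun k e => h.ne (smul_left_cancel k e)
  have n2 : ∀ k : G, k • q ≠ k • p := fun k e => n1 k e.symm
  have nx : x • p ≠ p := h.hg.1
  have ny : y • q ≠ q := h.hh.1
  have step : ∀ {a b c : X}, a ≠ b → Bt p (x • p) b ∧ Bt p a b → Bt a b c →
      Bt p (x • p) c ∧ Bt p b c := by
    intro a b c hab h1 h2
    have := (h1.2.chain h2 hab).2
    exact ⟨h1.1.trans1 this, this⟩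
  have s1 : Bt p (x • p) (x • q) := by simpa using h.a2.smul x
  have s2 := step (n1 x) ⟨s1, s1⟩ (h.b1.smul x)
  have m2 : x • q ≠ x • y • q := fun e => ny (smul_left_cancel x e).symm
  have s3 := step m2 s2 (c := x • y • p) (by
    have := (h.b2.smul (x * y)).symm; simpa [mul_smul] using this)
  have s4 := step (by simpa [mul_smul] using n2 (x * y)) s3 (c := x • y • x⁻¹ • p) (by
    have := (h.a2.smul (x * y)).symm; simpa [mul_smul] using this)
  have m4 : x • y • p ≠ x • y • x⁻¹ • p := by
    intro e
    have e2 := smul_left_cancel y (smul_left_cancel x e)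
    exact nx (by rw [← inv_smul_eq_iff.1 e2.symm])
  have s5 := step m4 s4 (c := x • y • x⁻¹ • q) (by
    have := (h.a1.smul (x * y * x⁻¹)); simpa [mul_smul] using this)
  have s6 := step (by simpa [mul_smul] using n1 (x * y * x⁻¹)) s5
    (c := x • y • x⁻¹ • y⁻¹ • q) (by
    have := (h.b2.smul (x * y * x⁻¹)); simpa [mul_smul] using this)
  have m6 : x • y • x⁻¹ • q ≠ x • y • x⁻¹ • y⁻¹ • q := by
    intro e
    have e2 := smul_left_cancel x⁻¹ (smul_left_cancel y (smul_left_cancel x e))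
    exact ny (by rw [← inv_smul_eq_iff.1 e2.symm])
  have s7 := step m6 s6 (c := x • y • x⁻¹ • y⁻¹ • p) (by
    have := (h.b1.smul (x * y * x⁻¹ * y⁻¹)).symm; simpa [mul_smul] using this)
  have s8 := step (by simpa [mul_smul] using n2 (x * y * x⁻¹ * y⁻¹)) s7
    (c := x • y • x⁻¹ • y⁻¹ • x • p) (by
    have := (h.a1.smul (x * y * x⁻¹ * y⁻¹)).symm; simpa [mul_smul] using this)
  have m8 : x • y • x⁻¹ • y⁻¹ • p ≠ x • y • x⁻¹ • y⁻¹ • x • p := by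
    intro e
    have e2 := smul_left_cancel y⁻¹
      (smul_left_cancel x⁻¹ (smul_left_cancel y (smul_left_cancel x e)))
    exact nx e2.symm
  set c := x * y * x⁻¹ * y⁻¹ with hc
  have ec : ∀ z : X, x • y • x⁻¹ • y⁻¹ • z = c • z := by intro z; simp [hc, mul_smul]
  rw [ec] at s7
  rw [ec, ec] at s8 m8
  have s9 := step m8 s8 (s7.1.smul c)
  have hle : dist p (x • p) ≤ dist p (c • p) := by
    have := s7.1
    have h0 := @dist_nonneg X _ (x • p) (c • p)
    unfold Bt at this; linarith
  refine ⟨⟨?_, ?_⟩, hle⟩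
  · have := h.hg.pos
    exact (dist_pos.1 (lt_of_lt_of_le this hle)).symm
  · exact s8.2.trans1 s9.2

theorem Ax.slide {x : G} {a b z : X} {n : ℕ} (hx : Ax x a) (hb : Bt a b (x ^ n • a))
    (hz : Bt a z b) (hd : dist a (x • a) + dist a z ≤ dist a b) :
    Bt a (x • z) b ∧ dist a (x • z) = dist a (x • a) + dist a z := by
  have h1 : Bt (x • a) (x • z) (x ^ (n + 1) • a) := by
    have := (hz.trans1 hb).smul x
    simpa [pow_succ', mul_smul] using this
  have h2 : Bt a (x • a) (x ^ (n + 1) • a) := by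
    have e : dist (x • a) (x ^ (n + 1) • a) = dist a (x ^ n • a) := by
      rw [pow_succ', mul_smul, dist_smul]
    unfold Bt; rw [e, hx.pow, hx.pow]; push_cast; ring
  have h3 : Bt a (x • z) (x ^ (n + 1) • a) := by
    have := h1.symm.trans1 h2.symm
    exact this.symm
  have h4 : Bt a (x • a) (x • z) := (h1.symm.trans2 h2.symm).symm
  have h5 : Bt a (x ^ n • a) (x ^ (n + 1) • a) := by
    have e : dist (x ^ n • a) (x ^ (n + 1) • a) = dist a (x • a) := by
      rw [pow_succ, mul_smul, dist_smul]
    unfold Bt; rw [e, hx.pow, hx.pow]; push_cast; ring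
  have h6 := hb.trans1 h5
  have h7 : dist a (x • z) = dist a (x • a) + dist a z := by
    have := dist_smul x a z
    unfold Bt at h4; linarith
  exact ⟨h3.lin h6 (by linarith), h7⟩

theorem Ax.dir {x : G} {a b : X} (ha : Ax x a) (hb : Ax x b) :
    ∃ n : ℕ, Bt a b (x ^ n • a) ∨ Bt a b (x⁻¹ ^ n • a) := by
  obtain ⟨n, hn⟩ := ha.exists_n (dist b a)
  have hb' := hb.between ha n hn
  have ha' := ha.between ha n (by rw [dist_self]; exact lt_of_le_of_lt dist_nonneg hn)
  refine ⟨n, ?_⟩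
  rcases ha'.tot hb' with ⟨_, h⟩ | ⟨h1, h2⟩
  · exact Or.inl h
  · right; rw [inv_pow]; exact h1.symm

theorem Ax.commute_aux {x y : G} {a b : X} {n m : ℕ} (hxa : Ax x a)
    (hya : Ax y a) (hx : Bt a b (x ^ n • a)) (hy : Bt a b (y ^ m • a))
    (hd : dist a (x • a) + dist a (y • a) ≤ dist a b) : x • y • a = y • x • a := by
  have p1 := hxa.pos
  have p2 := hya.pos
  have h1 := hxa.slide hx (bt_left a b) (by rw [dist_self]; linarith)
  have h2 := hya.slide hy (bt_left a b) (by rw [dist_self]; linarith)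
  have h3 := hxa.slide hx h2.1 hd
  have h4 := hya.slide hy h1.1 (by linarith)
  exact h3.1.eq_of h4.1 (by linarith [h3.2, h4.2])

theorem Ax.commute {x y : G} {a b : X} (hxa : Ax x a) (hxb : Ax x b)
    (hya : Ax y a) (hyb : Ax y b)
    (hd : dist a (x • a) + dist a (y • a) ≤ dist a b) :
    ∃ w : X, (x * y * x⁻¹ * y⁻¹) • w = w := by
  have main : ∃ w : X, x • y • w = y • x • w := by
    obtain ⟨n, hn⟩ := hxa.dir hxb
    obtain ⟨m, hm⟩ := hya.dir hyb
    rcases hn with hn | hn <;> rcases hm with hm | hm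
    · exact ⟨a, hxa.commute_aux hya hn hm hd⟩
    · have := hxa.commute_aux hya.inv hn hm (by rwa [dist_inv_smul_self])
      refine ⟨y⁻¹ • a, ?_⟩
      rw [this]; simp
    · have := hxa.inv.commute_aux hya hn hm (by rwa [dist_inv_smul_self])
      refine ⟨x⁻¹ • a, ?_⟩
      rw [← this]; simp
    · have := hxa.inv.commute_aux hya.inv hn hm (by rwa [dist_inv_smul_self, dist_inv_smul_self])
      refine ⟨x⁻¹ • y⁻¹ • a, ?_⟩
      conv_lhs => rw [this]
      simp
  obtain ⟨w, hw⟩ := main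
  refine ⟨x • y • w, ?_⟩
  conv_lhs => rw [hw]
  simp [mul_smul]

/-- Distinct projections to an axis of points of another axis lie in that other axis. -/
theorem proj_mem {x y : G} {u v pu pv : X} (hu : Ax x u) (hv : Ax x v)
    (hpu : Ax y pu) (hpv : Ax y pv) (h1 : ∀ a, Ax y a → Bt u pu a)
    (h2 : ∀ a, Ax y a → Bt v pv a) (hne : pu ≠ pv) : Ax x pu ∧ Ax x pv := by
  have a1 := h1 pv hpv
  have a2 := h2 pu hpu
  have := a1.chain a2.symm hne
  exact ⟨hu.convex hv this.1, hu.convex hv this.2⟩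

theorem Ax.disjoint_cube {x y : G} (hc : ∀ w : X, (x * y * x⁻¹ * y⁻¹) • w ≠ w)
    {a b : X} (ha : Ax x a) (hb : Ax y b) (hl : dist a (x • a) = dist b (y • b))
    (c : X) (hc1 : Ax x c) : ¬ Ax (y ^ 3 * x * (y ^ 3)⁻¹) c := by
  intro hc2
  have hc3 := hc2.of_conj
  obtain ⟨p, hp, hp1, -, -⟩ := hb.proj c
  have hq : Ax y ((y ^ 3)⁻¹ • p) := by
    have := hp.smul (y ^ 3)⁻¹
    have e : (y ^ 3)⁻¹ * y * ((y ^ 3)⁻¹)⁻¹ = y := by group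
    rwa [e] at this
  have hq1 : ∀ a, Ax y a → Bt ((y ^ 3)⁻¹ • c) ((y ^ 3)⁻¹ • p) a := by
    intro a ha
    have h1 : Ax y (y ^ 3 • a) := by
      have := ha.smul (y ^ 3)
      have e : (y ^ 3) * y * ((y ^ 3))⁻¹ = y := by group
      rwa [e] at this
    have := (hp1 _ h1).smul (y ^ 3)⁻¹
    simpa using this
  have hd : dist ((y ^ 3)⁻¹ • p) p = 3 * dist p (y • p) := by
    rw [dist_inv_smul, hp.pow]; norm_num
  have hpos := hp.pos
  have hne : (y ^ 3)⁻¹ • p ≠ p := by rw [← dist_pos, hd]; linarith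
  obtain ⟨m1, m2⟩ := proj_mem hc3 hc1 hq hp hq1 hp1 hne
  obtain ⟨w, hw⟩ := m1.commute m2 hq hp (by
    rw [hd, m1.eq ha, hl, hq.eq hp, hb.eq hp]; linarith)
  exact hc w hw

end AbstractTrees

section RealTreeFacts

theorem MTree.of_lin {X : Type u} [MetricSpace X]
    (med : ∀ x y z : X, ∃ m : X, Bt x m y ∧ Bt y m z ∧ Bt x m z)
    (lin : ∀ w x p q : X, Bt w p x → Bt w q x → dist w p ≤ dist w q → Bt w p q) : MTree X where
  med := med
  four := by
    have key : ∀ w x y z : X, dist x z + dist w y ≤ dist x y + dist w z ∨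
        dist x z + dist w y ≤ dist y z + dist w x := by
      intro w x y z
      obtain ⟨m, h1, h2, h3⟩ := med w x y
      obtain ⟨n, k1, k2, k3⟩ := med w y z
      rcases le_total (dist w m) (dist w n) with h | h
      · have := (lin w y m n h3 k1 h).trans1 k3
        unfold Bt at *
        left
        have := dist_triangle x m z
        have := dist_comm x m
        linarith
      · have := (lin w y n m k1 h3 h).trans1 h1
        unfold Bt at *
        right
        have := dist_triangle x n z
        have := dist_comm x n
        have := dist_comm y n
        linarith
    intro x y z w
    rw [le_max_iff]
    have c1 := dist_comm z w
    have c2 := dist_comm y w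
    have c3 := dist_comm x w
    have c4 := dist_comm z y
    rcases key w x z y with h | h
    · left; linarith
    · right; linarith

/-- `f` is an isometric embedding on `[0,a]`. -/
def IsGeo {X : Type u} [MetricSpace X] (f : ℝ → X) (a : ℝ) : Prop :=
  ∀ s ∈ Set.Icc (0 : ℝ) a, ∀ t ∈ Set.Icc (0 : ℝ) a, dist (f s) (f t) = |s - t|

variable {G : Type u} [Group G]

theorem RGTree.arc (R : RGTree G) {f f' : ℝ → R.X} {a b : ℝ} (ha : 0 ≤ a) (hb : 0 ≤ b)
    (hf : IsGeo f a) (hf' : IsGeo f' b) (h0 : f 0 = f' 0)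
    (hm : ∀ s ∈ Set.Icc (0 : ℝ) a, ∀ t ∈ Set.Icc (0 : ℝ) b, f s = f' t → s = 0 ∨ t = 0) :
    Bt (f a) (f 0) (f' b) := by
  rcases eq_or_lt_of_le ha with ha0 | ha0
  · rw [← ha0]; exact bt_left _ _
  rcases eq_or_lt_of_le hb with hb0 | hb0
  · rw [← hb0, ← h0]; exact bt_right _ _
  set h : ℝ → R.X := fun r => if r ≤ 0 then f (-r) else f' r with hh
  have hneg : ∀ r, r ≤ 0 → h r = f (-r) := fun r hr => by simp [hh, hr]
  have hpos : ∀ r, 0 ≤ r → h r = f' r := fun r hr => by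
    rcases eq_or_lt_of_le hr with e | e
    · subst e; simp [hh, h0]
    · simp [hh, not_le.2 e]
  have hmix : ∀ r ∈ Set.Icc (-a) b, ∀ s ∈ Set.Icc (-a) b, r ≤ 0 → 0 ≤ s →
      dist (h r) (h s) ≤ |r - s| := by
    intro r hr s hs h1 h2
    rw [hneg r h1, hpos s h2]
    have t := dist_triangle (f (-r)) (f 0) (f' s)
    have e1 := hf (-r) ⟨by linarith, by linarith [hr.1]⟩ 0 ⟨le_rfl, ha⟩
    have e2 := hf' 0 ⟨le_rfl, hb⟩ s ⟨h2, hs.2⟩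
    rw [← h0] at e2
    rw [e1, e2, sub_zero, zero_sub, abs_neg, abs_neg, abs_of_nonpos h1, abs_of_nonneg h2] at t
    rw [abs_of_nonpos (by linarith)]; linarith
  have hlip : ∀ r ∈ Set.Icc (-a) b, ∀ s ∈ Set.Icc (-a) b, dist (h r) (h s) ≤ |r - s| := by
    intro r hr s hs
    rcases le_total r 0 with h1 | h1 <;> rcases le_total s 0 with h2 | h2
    · rw [hneg r h1, hneg s h2, hf _ ⟨by linarith, by linarith [hr.1]⟩ _
        ⟨by linarith, by linarith [hs.1]⟩]
      rw [show -r - -s = -(r - s) by ring, abs_neg]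
    · exact hmix r hr s hs h1 h2
    · rw [dist_comm, abs_sub_comm]; exact hmix s hs r hr h2 h1
    · rw [hpos r h1, hpos s h2, hf' _ ⟨h1, hr.2⟩ _ ⟨h2, hs.2⟩]
  have hinj : ∀ r ∈ Set.Icc (-a) b, ∀ s ∈ Set.Icc (-a) b, h r = h s → r = s := by
    have mix : ∀ r ∈ Set.Icc (-a) b, ∀ s ∈ Set.Icc (-a) b, r ≤ 0 → 0 ≤ s → h r = h s →
        r = s := by
      intro r hr s hs h1 h2 e
      rw [hneg r h1, hpos s h2] at e
      rcases hm (-r) ⟨by linarith, by linarith [hr.1]⟩ s ⟨h2, hs.2⟩ e with z | z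
      · rw [z, h0] at e
        have := hf' 0 ⟨le_rfl, hb⟩ s ⟨h2, hs.2⟩
        rw [e, dist_self] at this
        have := abs_eq_zero.1 this.symm
        linarith
      · rw [z, ← h0] at e
        have := hf (-r) ⟨by linarith, by linarith [hr.1]⟩ 0 ⟨le_rfl, ha⟩
        rw [e, dist_self] at this
        have := abs_eq_zero.1 this.symm
        linarith
    intro r hr s hs e
    rcases le_total r 0 with h1 | h1 <;> rcases le_total s 0 with h2 | h2
    · rw [hneg r h1, hneg s h2] at e
      have := hf (-r) ⟨by linarith, by linarith [hr.1]⟩ (-s) ⟨by linarith, by linarith [hs.1]⟩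
      rw [e, dist_self] at this
      have := abs_eq_zero.1 this.symm
      linarith
    · exact mix r hr s hs h1 h2 e
    · exact (mix s hs r hr h2 h1 e.symm).symm
    · rw [hpos r h1, hpos s h2] at e
      have := hf' _ ⟨h1, hr.2⟩ _ ⟨h2, hs.2⟩
      rw [e, dist_self] at this
      have := abs_eq_zero.1 this.symm
      linarith
  have hab : 0 < a + b := by linarith
  have mem : ∀ u : Set.Icc (0 : ℝ) 1, -a + u.1 * (a + b) ∈ Set.Icc (-a) b := by
    intro u
    constructor
    · have := mul_nonneg u.2.1 hab.le; linarith
    · have := mul_le_mul_of_nonneg_right u.2.2 hab.le; linarith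
  have hγ : Continuous (fun u : Set.Icc (0 : ℝ) 1 => h (-a + u.1 * (a + b))) := by
    have h1 : ContinuousOn h (Set.Icc (-a) b) := by
      have : LipschitzOnWith 1 h (Set.Icc (-a) b) :=
        LipschitzOnWith.of_dist_le_mul fun x hx y hy => by
          simpa [Real.dist_eq] using hlip x hx y hy
      exact this.continuousOn
    exact h1.comp_continuous (by fun_prop) mem
  have := R.unique_arc (f a) (f' b) (fun u => h (-a + u.1 * (a + b))) hγ
    (by
      intro u v e
      have := hinj _ (mem u) _ (mem v) e
      have h3 : (u.1 - v.1) * (a + b) = 0 := by linarith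
      rcases mul_eq_zero.1 h3 with h4 | h4
      · exact Subtype.ext (by linarith)
      · linarith)
    (by
      change h (-a + 0 * (a + b)) = f a
      rw [zero_mul, add_zero, hneg _ (by linarith), neg_neg])
    (by
      change h (-a + 1 * (a + b)) = f' b
      rw [show -a + 1 * (a + b) = b by ring, hpos _ hb])
    (f 0) (by
      refine ⟨⟨a / (a + b), by positivity, by rw [div_le_one hab]; linarith⟩, ?_⟩
      change h (-a + a / (a + b) * (a + b)) = f 0
      rw [div_mul_cancel₀ _ hab.ne', neg_add_cancel, hneg _ le_rfl, neg_zero])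
  exact this

theorem RGTree.exists_geo (R : RGTree G) (x y : R.X) :
    ∃ f : ℝ → R.X, f 0 = x ∧ f (dist x y) = y ∧ IsGeo f (dist x y) := R.geodesic x y

theorem RGTree.med (R : RGTree G) (x y z : R.X) :
    ∃ m : R.X, Bt x m y ∧ Bt y m z ∧ Bt x m z := by
  obtain ⟨f, f0, f1, hf⟩ := R.exists_geo x y
  obtain ⟨k, k0, k1, hk⟩ := R.exists_geo x z
  set a := dist x y with ha
  set b := dist x z with hb
  have ha0 : 0 ≤ a := dist_nonneg
  have hb0 : 0 ≤ b := dist_nonneg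
  set S : Set ℝ := {t | 0 ≤ t ∧ t ≤ a ∧ t ≤ b ∧ f t = k t} with hS
  have S0 : (0 : ℝ) ∈ S := ⟨le_rfl, ha0, hb0, by rw [f0, k0]⟩
  have Sb : BddAbove S := ⟨a, fun t ht => ht.2.1⟩
  set t := sSup S with ht
  have t0 : 0 ≤ t := le_csSup Sb S0
  have ta : t ≤ a := csSup_le ⟨0, S0⟩ fun s hs => hs.2.1
  have tb : t ≤ b := csSup_le ⟨0, S0⟩ fun s hs => hs.2.2.1
  have et : f t = k t := by
    by_contra hne
    have hp := dist_pos.2 hne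
    obtain ⟨s, hs, hs'⟩ := exists_lt_of_lt_csSup ⟨0, S0⟩
      (show t - dist (f t) (k t) / 2 < sSup S by rw [← ht]; linarith)
    have hst : s ≤ t := le_csSup Sb hs
    have e1 := hf t ⟨t0, ta⟩ s ⟨hs.1, hs.2.1⟩
    have e2 := hk s ⟨hs.1, hs.2.2.1⟩ t ⟨t0, tb⟩
    have := dist_triangle (f t) (f s) (k t)
    rw [abs_of_nonneg (by linarith)] at e1
    rw [abs_of_nonpos (by linarith)] at e2
    rw [← hs.2.2.2] at e2
    linarith
  have arc := R.arc (f := fun s => f (t + s)) (f' := fun s => k (t + s)) (a := a - t) (b := b - t)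
    (by linarith) (by linarith)
    (fun s hs r hr => by
      change dist (f _) (f _) = _
      rw [hf _ ⟨by linarith [hs.1], by linarith [hs.2]⟩ _ ⟨by linarith [hr.1], by linarith [hr.2]⟩]
      congr 1; ring)
    (fun s hs r hr => by
      change dist (k _) (k _) = _
      rw [hk _ ⟨by linarith [hs.1], by linarith [hs.2]⟩ _ ⟨by linarith [hr.1], by linarith [hr.2]⟩]
      congr 1; ring)
    (by simpa using et)
    (fun s hs r hr e => by
      change f _ = k _ at e
      have e1 := hf 0 ⟨le_rfl, ha0⟩ (t + s) ⟨by linarith [hs.1], by linarith [hs.2]⟩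
      have e2 := hk 0 ⟨le_rfl, hb0⟩ (t + r) ⟨by linarith [hr.1], by linarith [hr.2]⟩
      rw [abs_of_nonpos (by linarith [hs.1])] at e1
      rw [abs_of_nonpos (by linarith [hr.1])] at e2
      rw [k0, ← e, ← f0] at e2
      have hrs : r = s := by linarith
      subst hrs
      have : t + r ≤ t := le_csSup Sb
        ⟨by linarith [hs.1], by linarith [hs.2], by linarith [hr.2], e⟩
      left; linarith [hs.1])
  simp only [add_sub_cancel, add_zero] at arc
  rw [f1, k1] at arc
  have g1 := hf 0 ⟨le_rfl, ha0⟩ t ⟨t0, ta⟩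
  have g2 := hf t ⟨t0, ta⟩ a ⟨ha0, le_rfl⟩
  have g3 := hk 0 ⟨le_rfl, hb0⟩ t ⟨t0, tb⟩
  have g4 := hk t ⟨t0, tb⟩ b ⟨hb0, le_rfl⟩
  rw [abs_of_nonpos (by linarith)] at g1 g2 g3 g4
  rw [f0] at g1
  rw [f1] at g2
  rw [k0, ← et] at g3
  rw [k1, ← et] at g4
  refine ⟨f t, ?_, arc, ?_⟩
  · unfold Bt; rw [← ha]; linarith
  · unfold Bt; rw [← hb]; linarith

theorem RGTree.concat (R : RGTree G) {x m y : R.X} (h : Bt x m y) :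
    ∃ f : ℝ → R.X, f 0 = x ∧ f (dist x m) = m ∧ f (dist x y) = y ∧ IsGeo f (dist x y) := by
  obtain ⟨f, f0, f1, hf⟩ := R.exists_geo x m
  obtain ⟨k, k0, k1, hk⟩ := R.exists_geo m y
  unfold Bt at h
  set a := dist x m with ha
  set b := dist m y with hb
  have ha0 : 0 ≤ a := dist_nonneg
  have hb0 : 0 ≤ b := dist_nonneg
  set F : ℝ → R.X := fun r => if r ≤ a then f r else k (r - a) with hF
  have F1 : ∀ r, r ≤ a → F r = f r := fun r hr => by simp [hF, hr]
  have F2 : ∀ r, a ≤ r → F r = k (r - a) := fun r hr => by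
    rcases eq_or_lt_of_le hr with e | e
    · subst e; simp [hF, k0, f1]
    · simp [hF, not_le.2 e]
  have mix : ∀ r s, 0 ≤ r → r ≤ a → a ≤ s → s ≤ a + b → dist (F r) (F s) = s - r := by
    intro r s h0 h1 h2 h3
    rw [F1 r h1, F2 s h2]
    have e1 := hf r ⟨h0, h1⟩ a ⟨ha0, le_rfl⟩
    have e2 := hk 0 ⟨le_rfl, hb0⟩ (s - a) ⟨by linarith, by linarith⟩
    have e3 := hf 0 ⟨le_rfl, ha0⟩ r ⟨h0, h1⟩
    have e4 := hk (s - a) ⟨by linarith, by linarith⟩ b ⟨hb0, le_rfl⟩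
    rw [abs_of_nonpos (by linarith)] at e1 e2 e3 e4
    rw [f1] at e1
    rw [k0] at e2
    rw [f0] at e3
    rw [k1] at e4
    have t1 := dist_triangle (f r) m (k (s - a))
    have t2 := dist_triangle4 x (f r) (k (s - a)) y
    linarith
  refine ⟨F, ?_, ?_, ?_, ?_⟩
  · rw [F1 0 ha0, f0]
  · rw [F1 a le_rfl, f1]
  · rw [F2 _ (by linarith), ← h, add_sub_cancel_left, k1]
  · intro s hs t ht
    rw [← h] at hs ht
    rcases le_total s a with h1 | h1 <;> rcases le_total t a with h2 | h2
    · rw [F1 s h1, F1 t h2, hf _ ⟨hs.1, h1⟩ _ ⟨ht.1, h2⟩]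
    · rw [mix s t hs.1 h1 h2 ht.2, abs_of_nonpos (by linarith)]; ring
    · rw [dist_comm, mix t s ht.1 h2 h1 hs.2, abs_of_nonneg (by linarith)]
    · rw [F2 s h1, F2 t h2, hk _ ⟨by linarith, by linarith [hs.2]⟩ _
        ⟨by linarith, by linarith [ht.2]⟩]
      congr 1; ring

theorem RGTree.uniq (R : RGTree G) {x y z z' : R.X} (h : Bt x z y) (h' : Bt x z' y)
    (e : dist x z = dist x z') : z = z' := by
  by_contra hne
  have hp := dist_pos.2 hne
  obtain ⟨m, m1, m2, m3⟩ := R.med x z z'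
  obtain ⟨n, n1, n2, n3⟩ := R.med y z z'
  obtain ⟨f, f0, f1, f2, hf⟩ := R.concat m2
  obtain ⟨k, k0, k1, hk⟩ := R.exists_geo z n
  unfold Bt at *
  have c1 := dist_comm m z
  have c2 := dist_comm n z
  have c3 := dist_comm z y
  have c4 := dist_comm z' y
  set s := dist z m with hs
  have d1 : dist m z' = s := by linarith
  have d2 : dist z z' = 2 * s := by linarith
  have d3 : dist z n = s := by linarith
  have d4 : dist n z' = s := by linarith
  rw [d2] at hf f2
  rw [d3] at hk k1
  have s0 : 0 < s := by linarith
  have arc := R.arc (f := f) (f' := k) (a := 3 / 2 * s) (b := s) (by linarith) s0.le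
    (fun u hu v hv => hf u ⟨hu.1, by linarith [hu.2]⟩ v ⟨hv.1, by linarith [hv.2]⟩) hk
    (by rw [f0, k0])
    (fun u hu v hv e1 => by
      by_contra! hc
      have u0 : 0 < u := lt_of_le_of_ne hu.1 (Ne.symm hc.1)
      have v0 : 0 < v := lt_of_le_of_ne hv.1 (Ne.symm hc.2)
      have b1 : dist x (f u) < dist x z := by
        have t1 := dist_triangle x m (f u)
        have t2 := hf s ⟨s0.le, by linarith⟩ u ⟨hu.1, by linarith [hu.2]⟩
        rw [f1] at t2
        rcases le_total u s with h1 | h1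
        · rw [abs_of_nonneg (by linarith)] at t2; linarith
        · rw [abs_of_nonpos (by linarith)] at t2; linarith [hu.2]
      have b2 : dist x z ≤ dist x (f u) := by
        rw [e1]
        have t1 := dist_triangle y n (k v)
        have t2 := hk s ⟨s0.le, le_rfl⟩ v hv
        rw [k1, abs_of_nonneg (by linarith [hv.2])] at t2
        have t3 := dist_triangle x (k v) y
        have t4 := dist_comm y (k v)
        linarith
      linarith)
  rw [k1, f0] at arc
  unfold Bt at arc
  have t1 := hf (3 / 2 * s) ⟨by linarith, by linarith⟩ (2 * s) ⟨by linarith, le_rfl⟩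
  have t2 := hf (3 / 2 * s) ⟨by linarith, by linarith⟩ 0 ⟨le_rfl, by linarith⟩
  rw [f2, abs_of_nonpos (by linarith)] at t1
  rw [f0, abs_of_nonneg (by linarith)] at t2
  have t3 := dist_triangle (f (3 / 2 * s)) z' n
  have t4 := dist_comm z' n
  linarith

theorem RGTree.pt (R : RGTree G) (x y : R.X) {t : ℝ} (h0 : 0 ≤ t) (h1 : t ≤ dist x y) :
    ∃ z : R.X, Bt x z y ∧ dist x z = t := by
  obtain ⟨f, f0, f1, hf⟩ := R.exists_geo x y
  have e1 := hf 0 ⟨le_rfl, dist_nonneg⟩ t ⟨h0, h1⟩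
  have e2 := hf t ⟨h0, h1⟩ _ ⟨dist_nonneg, le_rfl⟩
  rw [f0, abs_of_nonpos (by linarith)] at e1
  rw [f1, abs_of_nonpos (by linarith)] at e2
  exact ⟨f t, by unfold Bt; linarith, by linarith⟩

instance RGTree.mtree (R : RGTree G) : MTree R.X := MTree.of_lin R.med (by
  intro w x p q hp hq h
  obtain ⟨p', h1, h2⟩ := R.pt w q dist_nonneg h
  have := R.uniq (h1.trans1 hq) hp h2
  rwa [this] at h1)

instance RGTree.mulAct (R : RGTree G) : MulAction G R.X where
  smul g x := R.act g x
  one_smul x := by change R.act 1 x = x; simp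
  mul_smul g h x := by change R.act (g * h) x = R.act g (R.act h x); simp

theorem RGTree.act_eq (R : RGTree G) (g : G) (x : R.X) : R.act g x = g • x := rfl

instance RGTree.isoAct (R : RGTree G) : IsIsometricSMul G R.X := ⟨fun g => R.isom g⟩

theorem RGTree.fix_of_sq (R : RGTree G) {g : G} {p : R.X} (h : g • g • p = p) :
    ∃ x : R.X, g • x = x := by
  obtain ⟨z, h1, h2⟩ := R.pt p (g • p) (t := dist p (g • p) / 2)
    (by linarith [dist_nonneg (x := p) (y := g • p)]) (by linarith [dist_nonneg (x := p) (y := g • p)])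
  refine ⟨z, ?_⟩
  have h3 := h1.smul g
  rw [h] at h3
  refine (Bt.eq_of h3.symm h1 ?_)
  have h4 : dist (g • p) (g • z) = dist p z := dist_smul _ _ _
  unfold Bt at h1 h3
  have h5 : dist (g • p) p = dist p (g • p) := dist_comm _ _
  have h6 := dist_comm p (g • z)
  linarith

theorem RGTree.nonempty (R : RGTree G) : Nonempty R.X :=
  let ⟨⟨x, _, _⟩⟩ := R.nontrivial; ⟨x⟩

/-- Elliptic or hyperbolic. -/
theorem RGTree.cases (R : RGTree G) (g : G) :
    (∃ x : R.X, g • x = x) ∨ (∃ x : R.X, Ax g x) := by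
  obtain ⟨b⟩ := R.nonempty
  rcases dichotomy g b with ⟨p, hp, _⟩ | ⟨p, hp, _⟩
  · exact Or.inr ⟨p, hp⟩
  · exact Or.inl (R.fix_of_sq hp)

theorem RGTree.ell_le (R : RGTree G) (g : G) (x : R.X) : R.ell g ≤ dist x (g • x) :=
  csInf_le ⟨0, by rintro r ⟨x, rfl⟩; exact dist_nonneg⟩ ⟨x, rfl⟩

theorem RGTree.ell_nonneg (R : RGTree G) (g : G) : 0 ≤ R.ell g :=
  Real.sInf_nonneg (by rintro r ⟨x, rfl⟩; exact dist_nonneg)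

theorem RGTree.ell_fix (R : RGTree G) {g : G} {x : R.X} (h : g • x = x) : R.ell g = 0 :=
  le_antisymm (by simpa [h] using R.ell_le g x) (R.ell_nonneg g)

theorem RGTree.ell_ax (R : RGTree G) {g : G} {x : R.X} (h : Ax g x) :
    R.ell g = dist x (g • x) :=
  le_antisymm (R.ell_le g x) (le_csInf ⟨_, x, rfl⟩ (by rintro r ⟨y, rfl⟩; exact h.le y))

theorem RGTree.hyp_of_ax (R : RGTree G) {g : G} {x : R.X} (h : Ax g x) : R.Hyperbolic g :=
  fun y => h.not_fix y

theorem RGTree.ax_of_hyp (R : RGTree G) {g : G} (h : R.Hyperbolic g) : ∃ x : R.X, Ax g x := by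
  rcases R.cases g with ⟨x, hx⟩ | hx
  · exact absurd hx (h x)
  · exact hx

theorem RGTree.hyp_of_pos (R : RGTree G) {g : G} (h : 0 < R.ell g) : R.Hyperbolic g := by
  intro x hx
  rw [R.ell_fix hx] at h
  exact lt_irrefl _ h

theorem RGTree.pos_of_hyp (R : RGTree G) {g : G} (h : R.Hyperbolic g) : 0 < R.ell g := by
  obtain ⟨x, hx⟩ := R.ax_of_hyp h
  rw [R.ell_ax hx]; exact hx.pos

theorem RGTree.mem_axis_hyp (R : RGTree G) {g : G} (h : R.Hyperbolic g) (x : R.X) :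
    x ∈ R.Axis g ↔ Ax g x := by
  obtain ⟨y, hy⟩ := R.ax_of_hyp h
  constructor
  · intro hx
    exact hy.of_le (by rw [← R.ell_ax hy]; exact le_of_eq hx)
  · intro hx
    exact (R.ell_ax hx).symm

theorem RGTree.ell_formula (R : RGTree G) (g : G) (x : R.X) :
    R.ell g = max 0 (dist x (g • g • x) - dist x (g • x)) := by
  rcases R.cases g with ⟨w, hw⟩ | ⟨y, hy⟩
  · rw [R.ell_fix hw, max_eq_left]
    linarith [fix_le hw x]
  · obtain ⟨p, hp, _, h1, h2⟩ := hy.proj x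
    rw [R.ell_ax hp, max_eq_right] <;> linarith [hp.pos]

/-- `ℓ(g)` is attained. -/
theorem RGTree.ell_att (R : RGTree G) (g : G) : ∃ x : R.X, dist x (g • x) = R.ell g := by
  rcases R.cases g with ⟨w, hw⟩ | ⟨y, hy⟩
  · exact ⟨w, by rw [R.ell_fix hw, hw, dist_self]⟩
  · exact ⟨y, (R.ell_ax hy).symm⟩

theorem RGTree.axis_convex (R : RGTree G) {g : G} {x y z : R.X} (hx : x ∈ R.Axis g)
    (hy : y ∈ R.Axis g) (hz : Bt x z y) : z ∈ R.Axis g :=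
  le_antisymm (Ax.convex_disp (g := g) (le_of_eq hx) (le_of_eq hy) hz) (R.ell_le g z)

end RealTreeFacts

section AbstractTrees2

variable {X : Type u} [MetricSpace X] [MTree X]
variable {G : Type u} [Group G] [MulAction G X] [IsIsometricSMul G X]

theorem Bridge.symm {g h : G} {p q : X} (b : Bridge g h p q) : Bridge h g q p :=
  ⟨b.hh, b.hg, b.ne.symm, b.b1.symm, b.b2.symm, b.a1.symm, b.a2.symm⟩

theorem Bridge.proj {g h : G} {p q : X} (b : Bridge g h p q) (a : X) (ha : Ax g a) :
    Bt q p a := by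
  obtain ⟨p0, h0, h1, h2, -⟩ := b.hg.proj q
  have e1 : Bt p (g • p) (g • q) := by
    have := b.a2.smul g
    rwa [smul_inv_smul] at this
  have e2 := b.a1.symm.chain e1 b.hg.1.symm
  have e3 := h1 p b.hg
  have e4 := e2.1
  have e5 := h0.eq b.hg
  have e6 : dist (g • p) (g • q) = dist p q := dist_smul _ _ _
  have e7 := dist_comm p q
  have : dist p0 p = 0 := by unfold Bt at *; linarith
  rw [← dist_eq_zero.1 this]
  exact h1 a ha

theorem Bridge.chain {g h : G} {p q : X} (b : Bridge g h p q) {a w : X} (ha : Ax g a)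
    (hw : Ax h w) : Bt w q a ∧ Bt w p a :=
  (b.symm.proj w hw).symm.chain (b.proj a ha) b.ne.symm

theorem Bridge.dist_pos {g h : G} {p q : X} (b : Bridge g h p q) {a : X} (ha : Ax g a) :
    0 < dist q a := by
  have := b.proj a ha
  have h1 := _root_.dist_pos.2 b.ne.symm
  have h2 := dist_nonneg (x := p) (y := a)
  unfold Bt at this
  linarith

theorem Bridge.conj_pt {g h : G} {p q : X} (b : Bridge g h p q) {c w : X} (k : G)
    (hk : ∀ w : X, Ax h w → Ax h (k⁻¹ • w)) (hc : Ax (k * g * k⁻¹) c) (hw : Ax h w) :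
    Bt w (k • q) c ∧ 0 < dist (k • q) c := by
  have h1 := hc.of_conj
  have h2 := (b.chain h1 (hk w hw)).1.smul k
  have h3 := b.dist_pos h1
  rw [smul_inv_smul, smul_inv_smul] at h2
  refine ⟨h2, ?_⟩
  rw [← dist_smul k, smul_inv_smul] at h3
  exact h3

theorem Ax.smul_inv_self {g : G} {x : X} (hx : Ax g x) : Ax g (g⁻¹ • x) := by
  have := hx.inv.smul_self.inv
  rwa [inv_inv] at this

/-- Some conjugate of `g` has an axis disjoint from that of `γ`. -/
theorem Bridge.exists_disjoint {g h γ : G} {p q : X} (b : Bridge g h p q) :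
    ∃ k : G, (∃ x : X, Ax k x) ∧ ∀ x : X, Ax γ x → ¬ Ax k x := by
  by_contra! hno
  obtain ⟨a, a1, a2⟩ := hno g ⟨p, b.hg⟩
  obtain ⟨c, c1, c2⟩ := hno (h * g * h⁻¹) ⟨_, b.hg.smul h⟩
  obtain ⟨e, e1, e2⟩ := hno (h⁻¹ * g * h⁻¹⁻¹) ⟨_, b.hg.smul h⁻¹⟩
  have hc : ∀ w : X, Ax h w → Bt w (h • q) c ∧ 0 < dist (h • q) c := fun w hw =>
    b.conj_pt h (fun w hw => hw.smul_inv_self) c2 hw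
  have he : ∀ w : X, Ax h w → Bt w (h⁻¹ • q) e ∧ 0 < dist (h⁻¹ • q) e := fun w hw =>
    b.conj_pt h⁻¹ (fun w hw => by rw [inv_inv]; exact hw.smul_self) e2 hw
  have qh := b.hh.smul_self
  have qi := b.hh.smul_inv_self
  have ne1 : q ≠ h • q := b.hh.1.symm
  have ne2 : q ≠ h⁻¹ • q := b.hh.inv.1.symm
  have ne3 : h⁻¹ • q ≠ h • q := by
    intro hh
    have := b.hh.not_sq (h⁻¹ • q)
    rw [smul_inv_smul] at this
    exact this hh.symm
  have ac := (b.chain a2 qh).1.symm.chain (hc q b.hh).1 ne1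
  have ae := (b.chain a2 qi).1.symm.chain (he q b.hh).1 ne2
  have ec := (he _ qh).1.symm.chain (hc _ qi).1 ne3
  have pa := b.dist_pos a2
  have pc := (hc q b.hh).2
  have pe := (he q b.hh).2
  have t1 := dist_triangle e q c
  have t2 := dist_triangle a (h • q) e
  have t3 := dist_triangle a (h⁻¹ • q) c
  have d1 := dist_comm q a
  have d2 := dist_comm q e
  have d3 := dist_comm (h • q) e
  have d4 := dist_comm (h • q) c
  have d5 := dist_comm (h⁻¹ • q) e
  have d6 := dist_comm a e
  have d7 := dist_comm c e
  have d8 := dist_comm a c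
  rcases a1.collinear c1 e1 with h1 | h1 | h1 <;> unfold Bt at * <;> linarith

theorem Bridge.exists_comm {g h γ : G} {p q c : X} (b : Bridge g h p q) (hγ : Ax γ c) :
    ∃ k : G, ∃ w : X, Ax (γ * (k * γ * k⁻¹) * γ⁻¹ * (k * γ * k⁻¹)⁻¹) w := by
  obtain ⟨k, ⟨x, hx⟩, hk⟩ := b.exists_disjoint (γ := γ)
  obtain ⟨p', q', b'⟩ := hγ.exists_bridge hx hk
  exact ⟨k, p', b'.conj.comm.1⟩

end AbstractTrees2

section SimplicialFacts

open SimpleGraph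

variable {G : Type u} [Group G]

theorem isPath_append_of {V : Type u} {Γ : SimpleGraph V} {u v w : V} (p : Γ.Walk u v)
    (q : Γ.Walk v w) (hp : p.IsPath) (hq : q.IsPath)
    (h : ∀ a ∈ p.support, a ∈ q.support → a = v) : (p.append q).IsPath := by
  induction p with
  | nil => simpa using hq
  | cons e p ih =>
    rw [Walk.cons_append, Walk.cons_isPath_iff]
    rw [Walk.cons_isPath_iff] at hp
    refine ⟨ih q hp.1 hq fun a ha hb => h a (by simp [ha]) hb, fun hc => ?_⟩
    rw [Walk.mem_support_append_iff] at hc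
    rcases hc with hc | hc
    · exact hp.2 hc
    · have := h _ (by simp) hc
      apply hp.2
      rw [this]; simp

namespace MGTree

variable (T : MGTree G)

theorem walkLen_append {u v w : T.V} (p : T.graph.Walk u v) (q : T.graph.Walk v w) :
    T.walkLen (p.append q) = T.walkLen p + T.walkLen q := by
  simp [walkLen]

theorem walkLen_cons {u v w : T.V} (e : T.graph.Adj u v) (q : T.graph.Walk v w) :
    T.walkLen (Walk.cons e q) = T.len u v + T.walkLen q := by
  simp [walkLen]

theorem walkLen_nil (u : T.V) : T.walkLen (Walk.nil : T.graph.Walk u u) = 0 := by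
  simp [walkLen]

theorem walkLen_nonneg {u v : T.V} (p : T.graph.Walk u v) : 0 ≤ T.walkLen p := by
  induction p with
  | nil => rw [walkLen_nil]
  | cons e p ih => rw [walkLen_cons]; linarith [T.len_pos _ _ e]

theorem walkLen_pos {u v : T.V} (p : T.graph.Walk u v) (h : u ≠ v) : 0 < T.walkLen p := by
  cases p with
  | nil => exact absurd rfl h
  | cons e p => rw [walkLen_cons]; linarith [T.len_pos _ _ e, T.walkLen_nonneg p]

theorem walkLen_reverse {u v : T.V} (p : T.graph.Walk u v) :
    T.walkLen p.reverse = T.walkLen p := by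
  induction p with
  | nil => rfl
  | cons e p ih =>
    rw [Walk.reverse_cons, walkLen_append, walkLen_cons, walkLen_cons, walkLen_nil, ih,
      T.len_symm]
    ring

theorem exists_path (u v : T.V) : ∃ p : T.graph.Walk u v, p.IsPath :=
  (T.isTree.existsUnique_path u v).exists

theorem path_eq {u v : T.V} {p q : T.graph.Walk u v} (hp : p.IsPath) (hq : q.IsPath) : p = q :=
  (T.isTree.existsUnique_path u v).unique hp hq

theorem dist_eq {u v : T.V} {p : T.graph.Walk u v} (hp : p.IsPath) :
    T.dist u v = T.walkLen p := by
  have : {x : ℝ | ∃ p : T.graph.Walk u v, p.IsPath ∧ x = T.walkLen p} = {T.walkLen p} := by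
    ext x
    constructor
    · rintro ⟨q, hq, rfl⟩
      rw [T.path_eq hq hp]; rfl
    · rintro rfl
      exact ⟨p, hp, rfl⟩
  unfold dist
  rw [this, csInf_singleton]

theorem dist_add_of_mem {u v m : T.V} {p : T.graph.Walk u v} (hp : p.IsPath)
    (hm : m ∈ p.support) : T.dist u m + T.dist m v = T.dist u v := by
  rw [T.dist_eq hp, T.dist_eq (hp.takeUntil hm), T.dist_eq (hp.dropUntil hm),
    ← walkLen_append, Walk.take_spec]

theorem dist_self' (u : T.V) : T.dist u u = 0 := by
  rw [T.dist_eq (Walk.IsPath.nil (u := u)), walkLen_nil]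

theorem dist_nonneg' (u v : T.V) : 0 ≤ T.dist u v := by
  obtain ⟨p, hp⟩ := T.exists_path u v
  rw [T.dist_eq hp]; exact T.walkLen_nonneg p

theorem dist_comm' (u v : T.V) : T.dist u v = T.dist v u := by
  obtain ⟨p, hp⟩ := T.exists_path u v
  rw [T.dist_eq hp, T.dist_eq hp.reverse, walkLen_reverse]

theorem dist_le_adj {u a v : T.V} (e : T.graph.Adj u a) :
    T.dist u v ≤ T.len u a + T.dist a v := by
  obtain ⟨p, hp⟩ := T.exists_path a v
  by_cases hu : u ∈ p.support
  · have h1 := T.dist_add_of_mem hp hu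
    linarith [T.dist_nonneg' a u, T.len_pos _ _ e]
  · rw [T.dist_eq (hp.cons hu (h := e)), walkLen_cons, T.dist_eq hp]

theorem dist_le_walk {u v : T.V} (p : T.graph.Walk u v) : T.dist u v ≤ T.walkLen p := by
  induction p with
  | nil => rw [dist_self', walkLen_nil]
  | @cons u a v e p ih => rw [walkLen_cons]; linarith [T.dist_le_adj e (v := v)]

theorem isPath_of_len {u v : T.V} (p : T.graph.Walk u v) (h : T.walkLen p = T.dist u v) :
    p.IsPath := by
  induction p with
  | nil => exact Walk.IsPath.nil
  | @cons u a v e p ih =>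
    rw [walkLen_cons] at h
    have h1 := T.dist_le_adj e (v := v)
    have h2 := T.dist_le_walk p
    have h3 := ih (by linarith)
    refine h3.cons fun hu => ?_
    have h4 := T.dist_add_of_mem h3 hu
    linarith [T.dist_nonneg' a u, T.len_pos _ _ e]

theorem dist_triangle' (u v w : T.V) : T.dist u w ≤ T.dist u v + T.dist v w := by
  obtain ⟨p, hp⟩ := T.exists_path u v
  obtain ⟨q, hq⟩ := T.exists_path v w
  rw [T.dist_eq hp, T.dist_eq hq, ← walkLen_append]
  exact T.dist_le_walk _

theorem mem_of_dist_add {u v m : T.V} {p : T.graph.Walk u v} (hp : p.IsPath)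
    (h : T.dist u m + T.dist m v = T.dist u v) : m ∈ p.support := by
  obtain ⟨q, hq⟩ := T.exists_path u m
  obtain ⟨r, hr⟩ := T.exists_path m v
  have : (q.append r).IsPath := T.isPath_of_len _ (by
    rw [walkLen_append, ← T.dist_eq hq, ← T.dist_eq hr, h])
  rw [T.path_eq hp this, Walk.mem_support_append_iff]
  left; simp

noncomputable instance metric (T : MGTree G) : MetricSpace T.V where
  dist := T.dist
  dist_self := T.dist_self'
  dist_comm := T.dist_comm'
  dist_triangle := T.dist_triangle'
  eq_of_dist_eq_zero := by
    intro u v h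
    by_contra hne
    obtain ⟨p, hp⟩ := T.exists_path u v
    have := T.walkLen_pos p hne
    rw [← T.dist_eq hp] at this
    exact this.ne' h

theorem bt_iff {u v m : T.V} {p : T.graph.Walk u v} (hp : p.IsPath) :
    Bt u m v ↔ m ∈ p.support :=
  ⟨fun h => T.mem_of_dist_add hp h, fun h => T.dist_add_of_mem hp h⟩

theorem med (x y z : T.V) : ∃ m : T.V, Bt x m y ∧ Bt y m z ∧ Bt x m z := by
  obtain ⟨p, hp⟩ := T.exists_path y z
  obtain ⟨m, hm, hmin⟩ := p.support.toFinset.exists_min_image (fun a => Dist.dist x a)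
    ⟨y, by simp⟩
  rw [List.mem_toFinset] at hm
  obtain ⟨q, hq⟩ := T.exists_path x m
  have key : ∀ a ∈ q.support, a ∈ p.support → a = m := by
    intro a ha hb
    have h1 := (T.bt_iff hq).2 ha
    have h2 := hmin a (by simpa using hb)
    unfold Bt at h1
    have h3 := dist_nonneg (x := a) (y := m)
    exact dist_eq_zero.1 (by linarith)
  refine ⟨m, ?_, (T.bt_iff hp).2 hm, ?_⟩
  · have : (q.append (p.takeUntil m hm).reverse).IsPath := by
      refine isPath_append_of _ _ hq (hp.takeUntil hm).reverse fun a ha hb => key a ha ?_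
      rw [Walk.support_reverse, List.mem_reverse] at hb
      exact p.support_takeUntil_subset_support hm hb
    rw [T.bt_iff this]
    simp [Walk.mem_support_append_iff]
  · have : (q.append (p.dropUntil m hm)).IsPath := by
      refine isPath_append_of _ _ hq (hp.dropUntil hm) fun a ha hb => key a ha ?_
      exact p.support_dropUntil_subset_support hm hb
    rw [T.bt_iff this]
    simp [Walk.mem_support_append_iff]

instance mtree (T : MGTree G) : MTree T.V := MTree.of_lin T.med (by
  intro w x p q hp hq h
  obtain ⟨π, hπ⟩ := T.exists_path w x
  have hq' := (T.bt_iff hπ).1 hq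
  have hp' := (T.bt_iff hπ).1 hp
  rw [← Walk.take_spec π hq', Walk.mem_support_append_iff] at hp'
  rcases hp' with h1 | h1
  · exact (T.bt_iff (hπ.takeUntil hq')).2 h1
  · have h2 := (T.bt_iff (hπ.dropUntil hq')).2 h1
    unfold Bt at *
    have : Dist.dist q p = 0 := by
      have := dist_nonneg (x := q) (y := p)
      linarith
    rw [dist_eq_zero.1 this]; simp)

instance mulAct (T : MGTree G) : MulAction G T.V where
  smul g x := T.act g x
  one_smul x := by change T.act 1 x = x; simp
  mul_smul g h x := by change T.act (g * h) x = T.act g (T.act h x); simp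

theorem act_eq (g : G) (x : T.V) : T.act g x = g • x := rfl

/-- the action as a graph homomorphism -/
def actHom (g : G) : T.graph →g T.graph := ⟨fun v => T.act g v, fun {u v} h => T.adj_act g u v h⟩

theorem actHom_inj (g : G) : Function.Injective (T.actHom g) := (T.act g).injective

theorem walkLen_map (g : G) {u v : T.V} (p : T.graph.Walk u v) :
    T.walkLen (p.map (T.actHom g)) = T.walkLen p := by
  induction p with
  | nil => rfl
  | cons e p ih =>
    rw [Walk.map_cons, walkLen_cons, walkLen_cons, ih]
    congr 1
    exact T.len_equivariant g _ _

instance isoAct (T : MGTree G) : IsIsometricSMul G T.V := ⟨fun g => Isometry.of_dist_eq (by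
  intro u v
  obtain ⟨p, hp⟩ := T.exists_path u v
  change T.dist _ _ = T.dist _ _
  rw [T.dist_eq hp, ← T.walkLen_map g p]
  exact T.dist_eq (hp.map (T.actHom_inj g)))⟩

theorem fix_of_sq {g : G} {p : T.V} (h : g • g • p = p) : ∃ x : T.V, g • x = x := by
  obtain ⟨q, hq⟩ := T.exists_path p (g • p)
  have h' : T.actHom g (g • p) = p := h
  have h'' : T.actHom g p = g • p := rfl
  have h1 : ((q.map (T.actHom g)).copy h'' h').IsPath := by
    rw [Walk.isPath_copy]
    exact hq.map (T.actHom_inj g)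
  have h2 := T.path_eq h1 hq.reverse
  have h3 : ∀ i, g • q.getVert i = q.getVert (q.length - i) := by
    intro i
    have := congrArg (fun w => w.getVert i) h2
    simp only [Walk.getVert_copy, Walk.getVert_map, Walk.getVert_reverse] at this
    exact this
  rcases Nat.even_or_odd' q.length with ⟨k, hk | hk⟩
  · refine ⟨q.getVert k, ?_⟩
    rw [h3, hk]; congr 1; omega
  · exfalso
    refine T.noInversion g (q.getVert k) (q.getVert (k + 1))
      (q.adj_getVert_succ (by omega)) ⟨?_, ?_⟩
    · exact (h3 k).trans (by congr 1; omega)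
    · exact (h3 (k + 1)).trans (by congr 1; omega)

theorem ax_of_hyp {g : G} (h : T.toGTree.Hyperbolic g) : ∃ v : T.V, Ax g v := by
  obtain ⟨b⟩ := T.nonempty
  rcases dichotomy (X := T.V) g b with ⟨p, hp, _⟩ | ⟨p, hp, _⟩
  · exact ⟨p, hp⟩
  · obtain ⟨x, hx⟩ := T.fix_of_sq hp
    exact absurd hx (h x)

theorem mem_axis_of_ax {g : G} {v : T.V} (h : Ax g v) : v ∈ T.Axis g := by
  refine le_antisymm (le_csInf ⟨_, v, rfl⟩ ?_) (csInf_le ⟨0, ?_⟩ ⟨v, rfl⟩)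
  · rintro r ⟨y, rfl⟩; exact h.le y
  · rintro r ⟨y, rfl⟩; exact T.dist_nonneg' _ _

theorem exists_comm (hirr : T.Irr) {γ : G} (hγ : T.toGTree.Hyperbolic γ) :
    ∃ k : G, T.toGTree.Hyperbolic (γ * (k * γ * k⁻¹) * γ⁻¹ * (k * γ * k⁻¹)⁻¹) := by
  obtain ⟨g, h, hg, hh, hd⟩ := hirr
  obtain ⟨a, ha⟩ := T.ax_of_hyp hg
  obtain ⟨b, hb⟩ := T.ax_of_hyp hh
  obtain ⟨c, hc⟩ := T.ax_of_hyp hγ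
  obtain ⟨p, q, br⟩ := ha.exists_bridge hb (fun x h1 h2 => by
    have : x ∈ T.Axis g ∩ T.Axis h := ⟨T.mem_axis_of_ax h1, T.mem_axis_of_ax h2⟩
    rw [hd] at this
    exact this)
  obtain ⟨k, w, hw⟩ := br.exists_comm hc
  exact ⟨k, fun v => hw.not_fix v⟩

end MGTree

theorem SameDef.hyp_iff {T T' : GTree G} (h : SameDef T T') (g : G) :
    T.Hyperbolic g ↔ T'.Hyperbolic g := by
  have key : ∀ S : GTree G, S.Hyperbolic g ↔ ¬ S.Elliptic (Subgroup.zpowers g) := by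
    intro S
    unfold GTree.Hyperbolic GTree.Elliptic
    push Not
    constructor
    · intro hS v
      exact ⟨g, Subgroup.mem_zpowers g, hS v⟩
    · intro hS v hv
      obtain ⟨k, hk, hkv⟩ := hS v
      have : Subgroup.zpowers g ≤ S.stab v := by
        rw [Subgroup.zpowers_le]; exact hv
      exact hkv (this hk)
  rw [key, key, h]

theorem RealizationOf.hyp_iff {R : RGTree G} {T : MGTree G} (h : RealizationOf R T) (g : G) :
    T.toGTree.Hyperbolic g ↔ R.Hyperbolic g := by
  obtain ⟨f, h1, h2, -⟩ := h
  constructor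
  · intro hg
    obtain ⟨v, hv⟩ := T.ax_of_hyp hg
    apply R.hyp_of_ax (x := f v)
    have e1 : g • f v = f (g • v) := (h1 g v).symm
    have e2 : g • g • f v = f (g • g • v) := by rw [e1]; exact (h1 g _).symm
    constructor
    · intro hf
      have h3 := h2 (g • v) v
      rw [← e1, hf, _root_.dist_self] at h3
      exact hv.1 (dist_eq_zero.1 h3.symm)
    · have := hv.2
      unfold Bt at *
      rw [e2, e1, h2, h2, h2]
      exact this
  · intro hg v hv
    apply hg (f v)
    rw [← h1, hv]

end SimplicialFacts

section Serre

variable {X : Type u} [MetricSpace X] [MTree X]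
variable {G : Type u} [Group G] [MulAction G X] [IsIsometricSMul G X]

theorem fix_med {t : G} {w : X} (hw : t • w = w) (x : X) :
    ∃ y : X, t • y = y ∧ Bt x y (t • x) ∧ Bt x y w := by
  obtain ⟨m, h1, h2, h3⟩ := MTree.med x (t • x) w
  have h4 := h3.smul t
  rw [hw] at h4
  refine ⟨m, Bt.eq_of h4.symm h2.symm ?_, h1, h3⟩
  have : dist (t • m) (t • w) = dist m w := dist_smul _ _ _
  rw [hw] at this
  rw [dist_comm, this, dist_comm]

theorem fix_inter {s t : G} {a b c : X} (ha : s • a = a) (hb : t • b = b)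
    (hc : (t * s) • c = c) : ∃ y : X, s • y = y ∧ t • y = y := by
  obtain ⟨y, y1, y2, -⟩ := fix_med hb a
  obtain ⟨z, z1, z2, z3⟩ := fix_med ha y
  by_cases hne : y = z
  · exact ⟨y, by rw [hne]; exact z1, y1⟩
  exfalso
  have h1 : Bt (t • z) y z := by
    have h2 := z3.smul t
    rw [y1] at h2
    have h5 : Bt (t • a) y z := (z3.symm.trans2 y2).symm
    exact h2.symm.trans2 h5
  have h3 : Bt y (t • z) (t • s • y) := by
    have := z2.smul t
    rwa [y1] at this
  have h4 : Bt (t • z) (t • s • y) (t • s • t • z) := by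
    have := (h1.symm.smul s).smul t
    rwa [z1] at this
  have n1 : y ≠ t • z := by
    intro h; rw [← y1] at h; exact hne (smul_left_cancel t h)
  have n2 : t • z ≠ t • s • y := by
    intro h
    have := smul_left_cancel t h
    rw [← z1] at this
    exact hne (smul_left_cancel s this).symm
  have h5 := (h1.symm.chain h3 n1).2
  have h6 := (h5.chain h4 n2).1
  have : Ax (t * s) z := by
    constructor
    · intro h
      rw [mul_smul, z1] at h
      rw [h] at h1
      unfold Bt at h1
      rw [dist_self] at h1
      have := dist_nonneg (x := y) (y := z)
      have := dist_nonneg (x := z) (y := y)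
      exact hne (dist_eq_zero.1 (by linarith))
    · rw [mul_smul, mul_smul, z1]; exact h6
  exact this.not_fix c hc

theorem fix_convex {s : G} {x y z : X} (hx : s • x = x) (hy : s • y = y) (h : Bt x z y) :
    s • z = z := by
  have h1 := h.smul s
  rw [hx, hy] at h1
  refine Bt.eq_of h1 h ?_
  have : dist (s • x) (s • z) = dist x z := dist_smul _ _ _
  rwa [hx] at this

theorem helly (l : List G) : ∀ D : Set X, D.Nonempty →
    (∀ x ∈ D, ∀ y ∈ D, ∀ z, Bt x z y → z ∈ D) →
    (∀ s ∈ l, ∀ t ∈ l, ∃ x ∈ D, s • x = x ∧ t • x = x) →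
    ∃ x ∈ D, ∀ s ∈ l, s • x = x := by
  induction l with
  | nil => intro D ⟨x, hx⟩ _ _; exact ⟨x, hx, by simp⟩
  | cons s l ih =>
    intro D hD hconv hpair
    obtain ⟨x, hx, h1⟩ := ih (D ∩ {x | s • x = x})
      (by obtain ⟨x, hx, h1, _⟩ := hpair s (by simp) s (by simp); exact ⟨x, hx, h1⟩)
      (by
        rintro x ⟨hx, hx'⟩ y ⟨hy, hy'⟩ z hz
        exact ⟨hconv x hx y hy z hz, fix_convex hx' hy' hz⟩)
      (by
        intro t ht r hr
        obtain ⟨a, a1, a2, a3⟩ := hpair t (by simp [ht]) r (by simp [hr])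
        obtain ⟨b, b1, b2, b3⟩ := hpair s (by simp) t (by simp [ht])
        obtain ⟨c, c1, c2, c3⟩ := hpair s (by simp) r (by simp [hr])
        obtain ⟨m, m1, m2, m3⟩ := MTree.med a b c
        exact ⟨m, ⟨hconv _ a1 _ b1 _ m1, fix_convex b2 c2 m2⟩, fix_convex a2 b3 m1,
          fix_convex a3 c3 m3⟩)
    refine ⟨x, hx.1, fun t ht => ?_⟩
    rcases List.mem_cons.1 ht with rfl | ht
    · exact hx.2
    · exact h1 t ht

end Serre

theorem RGTree.exists_hyp {G : Type u} [Group G] [Group.FG G] (R : RGTree G) :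
    ∃ γ : G, R.Hyperbolic γ := by
  by_contra! hno
  have hfix : ∀ g : G, ∃ x : R.X, g • x = x := by
    intro g
    have := hno g
    unfold RGTree.Hyperbolic at this
    push Not at this
    exact this
  obtain ⟨S, hS⟩ := Group.fg_def.1 (inferInstance : Group.FG G)
  obtain ⟨x0⟩ := R.nonempty
  obtain ⟨x, -, hx⟩ := helly (X := R.X) S.toList Set.univ ⟨x0, trivial⟩
    (fun _ _ _ _ _ _ => trivial) (fun s _ t _ => by
      obtain ⟨a, ha⟩ := hfix s
      obtain ⟨b, hb⟩ := hfix t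
      obtain ⟨c, hc⟩ := hfix (t * s)
      obtain ⟨y, hy⟩ := fix_inter ha hb hc
      exact ⟨y, trivial, hy⟩)
  have hall : ∀ g : G, g • x = x := by
    intro g
    have : Subgroup.closure (S : Set G) ≤ MulAction.stabilizer G x := by
      rw [Subgroup.closure_le]
      intro s hs
      exact hx s (by simpa using hs)
    rw [hS] at this
    exact this (Subgroup.mem_top g)
  have := R.minimal {x} ⟨x, rfl⟩ (by rintro g y rfl; exact hall g) (by
    rintro a rfl b rfl z hz
    rw [dist_self] at hz
    have h1 := dist_nonneg (x := b) (y := z)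
    have h2 := dist_nonneg (x := z) (y := b)
    exact dist_eq_zero.1 (by linarith))
  obtain ⟨a, b, hab⟩ := R.nontrivial
  have ha : a ∈ ({x} : Set R.X) := by rw [this]; trivial
  have hb : b ∈ ({x} : Set R.X) := by rw [this]; trivial
  exact hab (ha.trans hb.symm)

section Topology

variable {G : Type u} [Group G]

/-- The basic Gromov neighbourhood relation. -/
def GNear (R : RGTree G) (X : Finset R.X) (A : Finset G) (ε : ℝ) (R' : RGTree G)
    (f : R.X → R'.X) : Prop :=
  ∀ x ∈ X, ∀ y ∈ X, ∀ g ∈ A, |dist x (g • y) - dist (f x) (g • f y)| < ε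

theorem gromov_iff (D : Set (RGTree G)) (R : RGTree G) :
    R ∈ @closure _ (gromovTopR G) D ↔ ∀ (X : Finset R.X) (A : Finset G) (ε : ℝ), 0 < ε →
      ∃ R' ∈ D, ∃ f : R.X → R'.X, GNear R X A ε R' f := by
  letI := gromovTopR G
  rw [mem_closure_iff]
  constructor
  · intro h X A ε hε
    have hopen : IsOpen {R' : RGTree G | ∃ f : R.X → R'.X, GNear R X A ε R' f} := by
      rintro R' ⟨f, hf⟩
      have hδ : ∃ δ : ℝ, 0 < δ ∧ ∀ x ∈ X, ∀ y ∈ X, ∀ g ∈ A,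
          |dist x (g • y) - dist (f x) (g • f y)| < ε - δ := by
        have : ∀ᶠ δ : ℝ in nhdsWithin 0 (Set.Ioi 0), ∀ x ∈ X, ∀ y ∈ X, ∀ g ∈ A,
            |dist x (g • y) - dist (f x) (g • f y)| < ε - δ := by
          rw [Filter.eventually_all_finset]
          intro x hx
          rw [Filter.eventually_all_finset]
          intro y hy
          rw [Filter.eventually_all_finset]
          intro g hg
          have h1 := hf x hx y hy g hg
          have h2 : ∀ᶠ δ : ℝ in nhds 0,
              δ < ε - |dist x (g • y) - dist (f x) (g • f y)| :=
            gt_mem_nhds (by linarith)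
          filter_upwards [nhdsWithin_le_nhds h2] with δ h3
          linarith
        obtain ⟨δ, h1, h2⟩ := (this.and self_mem_nhdsWithin).exists
        exact ⟨δ, h2, h1⟩
      obtain ⟨δ, h1, h2⟩ := hδ
      refine ⟨X.image f, A, δ, h1, ?_⟩
      rintro R'' ⟨f', hf'⟩
      refine ⟨f' ∘ f, fun x hx y hy g hg => ?_⟩
      have h3 := h2 x hx y hy g hg
      have h4 := hf' (f x) (Finset.mem_image_of_mem _ hx) (f y) (Finset.mem_image_of_mem _ hy) g hg
      have h5 := abs_sub_le (dist x (g • y)) (dist (f x) (g • f y))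
        (dist (f' (f x)) (g • f' (f y)))
      exact lt_of_le_of_lt h5 (by
        have : |dist (f x) (g • f y) - dist (f' (f x)) (g • f' (f y))| < δ := h4
        linarith)
    obtain ⟨R', h1, h2⟩ := h _ hopen ⟨id, fun x _ y _ g _ => by simpa using hε⟩
    obtain ⟨f, hf⟩ := h1
    exact ⟨R', h2, f, hf⟩
  · intro h U hU hRU
    obtain ⟨X, A, ε, hε, hsub⟩ := hU R hRU
    obtain ⟨R', h1, f, hf⟩ := h X A ε hε
    exact ⟨R', hsub ⟨f, hf⟩, h1⟩

theorem axes_iff (D : Set (RGTree G)) (R : RGTree G) :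
    R ∈ @closure _ (axesTopR G) D ↔ ∀ (F : Finset G) (ε : ℝ), 0 < ε →
      ∃ R' ∈ D, ∀ g ∈ F, |R'.ell g - R.ell g| < ε := by
  unfold axesTopR
  rw [closure_induced, mem_closure_iff]
  constructor
  · intro h F ε hε
    have hopen : IsOpen {u : G → ℝ | ∀ g ∈ F, |u g - R.ell g| < ε} := by
      have : {u : G → ℝ | ∀ g ∈ F, |u g - R.ell g| < ε} =
          ⋂ g ∈ F, {u : G → ℝ | |u g - R.ell g| < ε} := by ext; simp
      rw [this]
      refine isOpen_biInter_finset fun g _ => ?_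
      exact isOpen_lt (by fun_prop) continuous_const
    obtain ⟨u, h1, R', h2, rfl⟩ := h _ hopen (fun g _ => by simpa using hε)
    exact ⟨R', h2, h1⟩
  · intro h U hU hRU
    obtain ⟨I, u, h1, h2⟩ := isOpen_pi_iff.1 hU _ hRU
    have hδ : ∃ δ : ℝ, 0 < δ ∧ ∀ g ∈ I, ∀ r : ℝ, |r - R.ell g| < δ → r ∈ u g := by
      have : ∀ᶠ δ : ℝ in nhdsWithin 0 (Set.Ioi 0), ∀ g ∈ I, ∀ r : ℝ,
          |r - R.ell g| < δ → r ∈ u g := by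
        rw [Filter.eventually_all_finset]
        intro g hg
        obtain ⟨δ, h3, h4⟩ := Metric.isOpen_iff.1 (h1 g hg).1 _ (h1 g hg).2
        have h5 : ∀ᶠ δ' : ℝ in nhds 0, δ' < δ := gt_mem_nhds h3
        filter_upwards [nhdsWithin_le_nhds h5] with δ' h6 r hr
        apply h4
        rw [Metric.mem_ball, Real.dist_eq]
        linarith
      obtain ⟨δ, h3, h4⟩ := (this.and self_mem_nhdsWithin).exists
      exact ⟨δ, h4, h3⟩
    obtain ⟨δ, h3, h4⟩ := hδ
    obtain ⟨R', h5, h6⟩ := h I δ h3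
    exact ⟨_, h2 (fun g hg => h4 g hg _ (h6 g hg)), R', h5, rfl⟩

theorem ell_close {R R' : RGTree G} {x : R.X} {x' : R'.X} {g : G} {ε : ℝ}
    (h1 : |dist x (g • x) - dist x' (g • x')| < ε)
    (h2 : |dist x ((g * g) • x) - dist x' ((g * g) • x')| < ε) :
    |R.ell g - R'.ell g| < 2 * ε := by
  rw [R.ell_formula g x, R'.ell_formula g x']
  rw [mul_smul, mul_smul] at h2
  rw [abs_lt] at *
  rcases max_cases 0 (dist x (g • g • x) - dist x (g • x)) with ⟨e, h⟩ | ⟨e, h⟩ <;>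
  rcases max_cases 0 (dist x' (g • g • x') - dist x' (g • x')) with ⟨e', h'⟩ | ⟨e', h'⟩ <;>
  rw [e, e'] <;> constructor <;> linarith [h1.1, h1.2, h2.1, h2.2]

theorem gromov_sub_axes (D : Set (RGTree G)) :
    @closure _ (gromovTopR G) D ⊆ @closure _ (axesTopR G) D := by
  intro R hR
  rw [axes_iff]
  rw [gromov_iff] at hR
  intro F ε hε
  obtain ⟨x⟩ := R.nonempty
  obtain ⟨R', h1, f, hf⟩ := hR {x} (F ∪ F.image (fun g => g * g)) (ε / 2) (by linarith)
  refine ⟨R', h1, fun g hg => ?_⟩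
  have e1 := hf x (by simp) x (by simp) g (by simp [hg])
  have e2 := hf x (by simp) x (by simp) (g * g)
    (Finset.mem_union_right _ (Finset.mem_image_of_mem _ hg))
  have := ell_close e1 e2
  rw [abs_sub_comm]; linarith

/-- Part (1). -/
theorem part_one (D : Set (RGTree G)) (R : RGTree G) (hR : R ∈ @closure _ (gromovTopR G) D)
    (g : G) (hg : ∀ R' ∈ D, R'.Hyperbolic g) {a b c : R.X} (ha : g • a = a) (hb : g • b = b)
    (hc : g • c = c) : Bt a b c ∨ Bt b a c ∨ Bt a c b := by
  rw [gromov_iff] at hR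
  by_contra! hno
  obtain ⟨n1, n2, n3⟩ := hno
  have gap : ∀ x y z : R.X, ¬ Bt x y z → 0 < dist x y + dist y z - dist x z := by
    intro x y z h
    rcases lt_or_eq_of_le (dist_triangle x y z) with h1 | h1
    · linarith
    · exact absurd h1.symm h
  have g1 := gap _ _ _ n1
  have g2 := gap _ _ _ n2
  have g3 := gap _ _ _ n3
  obtain ⟨ε, hε, i1, i2, i3⟩ : ∃ ε : ℝ, 0 < ε ∧ 10 * ε < dist a b + dist b c - dist a c ∧
      10 * ε < dist b a + dist a c - dist b c ∧ 10 * ε < dist a c + dist c b - dist a b := by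
    refine ⟨min (dist a b + dist b c - dist a c) (min (dist b a + dist a c - dist b c)
      (dist a c + dist c b - dist a b)) / 11, by positivity, ?_, ?_, ?_⟩
    · have := min_le_left (dist a b + dist b c - dist a c) (min (dist b a + dist a c - dist b c)
        (dist a c + dist c b - dist a b))
      linarith
    · have := (min_le_right (dist a b + dist b c - dist a c) (min (dist b a + dist a c - dist b c)
        (dist a c + dist c b - dist a b))).trans (min_le_left _ _)
      linarith
    · have := (min_le_right (dist a b + dist b c - dist a c) (min (dist b a + dist a c - dist b c)
        (dist a c + dist c b - dist a b))).trans (min_le_right _ _)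
      linarith
  obtain ⟨R', hR', f, hf⟩ := hR {a, b, c} {1, g} ε hε
  obtain ⟨y, hy⟩ := R'.ax_of_hyp (hg R' hR')
  have pr : ∀ x ∈ ({a, b, c} : Finset R.X), g • x = x → ∃ p : R'.X, Ax g p ∧
      dist (f x) p < ε := by
    intro x hx hgx
    obtain ⟨p, hp, _, h1, _⟩ := hy.proj (f x)
    have h2 := hf x hx x hx g (by simp)
    rw [hgx, dist_self, abs_lt] at h2
    exact ⟨p, hp, by linarith [h2.1, hp.pos, dist_nonneg (x := f x) (y := p)]⟩
  obtain ⟨p, hp, dp⟩ := pr a (by simp) ha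
  obtain ⟨q, hq, dq⟩ := pr b (by simp) hb
  obtain ⟨r, hr, dr⟩ := pr c (by simp) hc
  have close : ∀ x ∈ ({a, b, c} : Finset R.X), ∀ y ∈ ({a, b, c} : Finset R.X), ∀ p q : R'.X,
      dist (f x) p < ε → dist (f y) q < ε → |dist x y - dist p q| < 3 * ε := by
    intro x hx y hy p q h1 h2
    have h3 := hf x hx y hy 1 (by simp)
    rw [one_smul, one_smul] at h3
    have t1 := dist_triangle4 (f x) p q (f y)
    have t2 := dist_triangle4 p (f x) (f y) q
    have c1 := dist_comm q (f y)
    have c2 := dist_comm p (f x)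
    rw [abs_lt] at *
    constructor <;> linarith [h3.1, h3.2]
  have k1 := abs_lt.1 (close a (by simp) b (by simp) p q dp dq)
  have k2 := abs_lt.1 (close b (by simp) c (by simp) q r dq dr)
  have k3 := abs_lt.1 (close a (by simp) c (by simp) p r dp dr)
  have c1 := dist_comm q p
  have c2 := dist_comm r q
  have c3 := dist_comm b a
  have c4 := dist_comm c b
  rcases hp.collinear hq hr with h | h | h <;> unfold Bt at h <;>
    linarith [k1.1, k1.2, k2.1, k2.2, k3.1, k3.2]

/-- Part (2), the length bound. -/
theorem part_two (D : Set (RGTree G)) (R : RGTree G) (hR : R ∈ @closure _ (gromovTopR G) D)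
    (g h : G) (hg : ∀ R' ∈ D, R'.Hyperbolic g) (hh : ∀ R' ∈ D, R'.Hyperbolic h)
    (hgh : ∀ R' ∈ D, R'.Hyperbolic (g * h * g⁻¹ * h⁻¹)) {x y : R.X}
    (xg : dist x (g • x) = R.ell g) (xh : dist x (h • x) = R.ell h)
    (yg : dist y (g • y) = R.ell g) (yh : dist y (h • y) = R.ell h) :
    dist x y ≤ R.ell g + R.ell h := by
  rw [gromov_iff] at hR
  by_contra! hlt
  obtain ⟨ε, hε⟩ : ∃ ε : ℝ, ε = (dist x y - (R.ell g + R.ell h)) / 20 := ⟨_, rfl⟩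
  have ε0 : 0 < ε := by rw [hε]; linarith
  obtain ⟨R', hR', f, hf⟩ := hR {x, y} {1, g, h, g * g, h * h} ε ε0
  obtain ⟨ag, hag⟩ := R'.ax_of_hyp (hg R' hR')
  obtain ⟨ah, hah⟩ := R'.ax_of_hyp (hh R' hR')
  have lg := abs_lt.1 (ell_close (hf x (by simp) x (by simp) g (by simp))
    (hf x (by simp) x (by simp) (g * g) (by simp)))
  have lh := abs_lt.1 (ell_close (hf x (by simp) x (by simp) h (by simp))
    (hf x (by simp) x (by simp) (h * h) (by simp)))
  have pr : ∀ z ∈ ({x, y} : Finset R.X), dist z (g • z) = R.ell g → dist z (h • z) = R.ell h →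
      ∃ p q : R'.X, Ax g p ∧ Ax h q ∧ (∀ a, Ax h a → Bt p q a) ∧ dist (f z) q ≤ 9 / 2 * ε := by
    intro z hz zg zh
    obtain ⟨p, hp, _, h1, _⟩ := hag.proj (f z)
    obtain ⟨r, hr, _, k1, _⟩ := hah.proj (f z)
    obtain ⟨q, hq, q1, _, _⟩ := hah.proj p
    refine ⟨p, q, hp, hq, q1, ?_⟩
    have e1 := abs_lt.1 (hf z hz z hz g (by simp))
    have e2 := abs_lt.1 (hf z hz z hz h (by simp))
    have l1 := R'.ell_ax hp
    have l2 := R'.ell_ax hr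
    have t1 := q1 r hr
    unfold Bt at t1
    have t2 := dist_triangle p (f z) r
    have t3 := dist_triangle (f z) p q
    have t4 := dist_nonneg (x := q) (y := r)
    have t5 := dist_comm p (f z)
    linarith [e1.1, e1.2, e2.1, e2.2, lg.1, lg.2, lh.1, lh.2]
  obtain ⟨p, q, hp, hq, q1, dq⟩ := pr x (by simp) xg xh
  obtain ⟨p', q', hp', hq', q1', dq'⟩ := pr y (by simp) yg yh
  have e := abs_lt.1 (hf x (by simp) y (by simp) 1 (by simp))
  rw [one_smul, one_smul] at e
  have t := dist_triangle4 (f x) q q' (f y)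
  have c := dist_comm q' (f y)
  have dqq : dist x y - 10 * ε < dist q q' := by linarith [e.1, e.2]
  have n1 := R.ell_nonneg g
  have n2 := R.ell_nonneg h
  have hne : q ≠ q' := by
    rw [← dist_pos]; linarith
  obtain ⟨m1, m2⟩ := proj_mem hp hp' hq hq' q1 q1' hne
  obtain ⟨w, hw⟩ := Ax.commute m1 m2 hq hq' (by
    rw [← R'.ell_ax m1, ← R'.ell_ax hq]
    linarith [lg.1, lg.2, lh.1, lh.2])
  exact hgh R' hR' w hw

theorem RGTree.ell_conj (R : RGTree G) (g k : G) : R.ell (k * g * k⁻¹) = R.ell g := by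
  have key : ∀ g k : G, R.ell (k * g * k⁻¹) ≤ R.ell g := by
    intro g k
    obtain ⟨x, hx⟩ := R.ell_att g
    have := R.ell_le (k * g * k⁻¹) (k • x)
    rw [mul_smul, inv_smul_smul, mul_smul, dist_smul, hx] at this
    exact this
  refine le_antisymm (key g k) ?_
  have := key (k * g * k⁻¹) k⁻¹
  rwa [show k⁻¹ * (k * g * k⁻¹) * k⁻¹⁻¹ = g by group] at this

theorem RGTree.hyp_conj (R : RGTree G) {g : G} (k : G) (hg : R.Hyperbolic g) :
    R.Hyperbolic (k * g * k⁻¹) :=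
  R.hyp_of_pos (by rw [R.ell_conj]; exact R.pos_of_hyp hg)

theorem RGTree.disjoint_cube (R : RGTree G) {x k : G} (hx : R.Hyperbolic x)
    (hc : R.Hyperbolic (x * (k * x * k⁻¹) * x⁻¹ * (k * x * k⁻¹)⁻¹)) (c : R.X) (h1 : Ax x c) :
    ¬ Ax ((k * x * k⁻¹) ^ 3 * x * ((k * x * k⁻¹) ^ 3)⁻¹) c := by
  obtain ⟨a, ha⟩ := R.ax_of_hyp hx
  obtain ⟨b, hb⟩ := R.ax_of_hyp (R.hyp_conj k hx)
  exact Ax.disjoint_cube (fun w => hc w) ha hb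
    (by rw [← R.ell_ax ha, ← R.ell_ax hb, R.ell_conj]) c h1

/-- Part (3). -/
theorem part_three [Group.FG G] (T₀ : MGTree G) (hirr : T₀.Irr) (D : Set (RGTree G))
    (hD : ∀ R' ∈ D, ∀ g : G, T₀.toGTree.Hyperbolic g ↔ R'.Hyperbolic g)
    (R : RGTree G) (hR : R ∈ @closure _ (axesTopR G) D) : R.Irr := by
  rw [axes_iff] at hR
  obtain ⟨γ, hγ⟩ := R.exists_hyp
  have lγ := R.pos_of_hyp hγ
  have hγ0 : T₀.toGTree.Hyperbolic γ := by
    obtain ⟨R', h1, h2⟩ := hR {γ} _ lγ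
    rw [hD R' h1]
    apply R'.hyp_of_pos
    have := (abs_lt.1 (h2 γ (by simp))).1
    linarith
  obtain ⟨k, hk⟩ := T₀.exists_comm hirr hγ0
  set K := (k * γ * k⁻¹) ^ 3 with hK
  set y' := K * γ * K⁻¹ with hy'
  have hlow : ∀ R' ∈ D, R'.ell γ ≤ R'.ell (γ * y' * γ⁻¹ * y'⁻¹) := by
    intro R' hR'
    have g1 := (hD R' hR' _).1 hγ0
    have g2 := (hD R' hR' _).1 hk
    obtain ⟨a, ha⟩ := R'.ax_of_hyp g1
    obtain ⟨b, hb⟩ := R'.ax_of_hyp (R'.hyp_conj K g1)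
    obtain ⟨p, q, br⟩ := ha.exists_bridge hb (R'.disjoint_cube g1 g2)
    rw [R'.ell_ax br.hg, R'.ell_ax br.comm.1]
    exact br.comm.2
  have hcom : R.Hyperbolic (γ * y' * γ⁻¹ * y'⁻¹) := by
    apply R.hyp_of_pos
    by_contra! hle
    obtain ⟨R', h1, h2⟩ := hR {γ, γ * y' * γ⁻¹ * y'⁻¹} (R.ell γ / 2) (by linarith)
    have e1 := abs_lt.1 (h2 γ (by simp))
    have e2 := abs_lt.1 (h2 (γ * y' * γ⁻¹ * y'⁻¹) (by simp))
    have e3 := hlow R' h1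
    linarith [e1.1, e2.2]
  refine ⟨γ, (K * γ * K⁻¹) ^ 3 * γ * ((K * γ * K⁻¹) ^ 3)⁻¹, hγ, R.hyp_conj _ hγ, ?_⟩
  rw [Set.eq_empty_iff_forall_notMem]
  rintro c ⟨c1, c2⟩
  rw [R.mem_axis_hyp hγ] at c1
  rw [R.mem_axis_hyp (R.hyp_conj _ hγ)] at c2
  exact R.disjoint_cube hγ hcom c c1 c2

end Topology

section BasePoint

variable {X : Type u} [MetricSpace X] [MTree X]
variable {G : Type u} [Group G] [MulAction G X] [IsIsometricSMul G X]

theorem Ax.of_mul {a k : G} {p : X} (ha : a • p ≠ p) (hk : k • p ≠ p)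
    (h1 : Bt (a⁻¹ • p) p (k • p)) (h2 : Bt (a • p) p (k⁻¹ • p)) :
    Ax (a * k) p ∧ dist p ((a * k) • p) = dist p (a • p) + dist p (k • p) := by
  have e1 : Bt p (a • p) (a • k • p) := by
    have := h1.smul a
    rwa [smul_inv_smul] at this
  have e2 : Bt (a • p) (a • k • p) (a • k • a • p) := by
    have := (h2.symm.smul k).smul a
    rwa [smul_inv_smul] at this
  have e3 : Bt (a • k • p) (a • k • a • p) (a • k • a • k • p) := (e1.smul k).smul a
  have n1 : a • p ≠ a • k • p := fun h => hk (smul_left_cancel a h).symm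
  have n2 : a • k • p ≠ a • k • a • p :=
    fun h => ha (smul_left_cancel k (smul_left_cancel a h)).symm
  have f1 := (e1.chain e2 n1).2
  have f2 := (f1.chain e3 n2).1
  have f3 : dist p ((a * k) • p) = dist p (a • p) + dist p (k • p) := by
    rw [mul_smul, ← e1, dist_smul]
  refine ⟨⟨?_, ?_⟩, f3⟩
  · intro h
    rw [h, dist_self] at f3
    have := dist_pos.2 ha.symm
    have := dist_nonneg (x := p) (y := k • p)
    linarith
  · simpa [mul_smul] using f2

theorem Bridge.far {g h : G} {p q : X} (b : Bridge g h p q) :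
    Bt p q (h • p) ∧ Bt p q (h⁻¹ • p) := by
  constructor
  · have c1 : Bt (h • p) (h • q) q := by
      have := b.b2.smul h
      rwa [smul_inv_smul] at this
    exact (b.b1.chain c1.symm b.hh.1.symm).1
  · have c1 : Bt (h⁻¹ • p) (h⁻¹ • q) q := by
      have := b.b1.smul h⁻¹
      rwa [inv_smul_smul] at this
    exact (b.b2.chain c1.symm b.hh.inv.1.symm).1

theorem Bridge.dirs {g h : G} {p q : X} (b : Bridge g h p q) :
    Bt (g • p) p (h • p) ∧ Bt (g • p) p (h⁻¹ • p) ∧ Bt (g⁻¹ • p) p (h • p) ∧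
      Bt (g⁻¹ • p) p (h⁻¹ • p) ∧ Bt (g • p) p (g⁻¹ • p) := by
  obtain ⟨f1, f2⟩ := b.far
  refine ⟨(b.a1.chain f1 b.ne).1, (b.a1.chain f2 b.ne).1, (b.a2.chain f1 b.ne).1,
    (b.a2.chain f2 b.ne).1, ?_⟩
  have := b.hg.2.smul g⁻¹
  rw [inv_smul_smul, inv_smul_smul] at this
  exact this.symm

theorem Bridge.h_ne {g h : G} {p q : X} (b : Bridge g h p q) : h • p ≠ p :=
  b.hh.not_fix p

theorem Bridge.dist_h {g h : G} {p q : X} (b : Bridge g h p q) :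
    dist p (h • p) = 2 * dist p q + dist q (h • q) := by
  have f1 := b.far.1
  have c1 : Bt (h • p) (h • q) q := by
    have := b.b2.smul h
    rwa [smul_inv_smul] at this
  unfold Bt at f1 c1
  rw [dist_smul] at c1
  rw [← f1, dist_comm q (h • p), ← c1, dist_comm q (h • q)]
  ring

theorem Bridge.gh {g h : G} {p q : X} (b : Bridge g h p q) :
    Ax (g * h) p ∧ dist p ((g * h) • p) = dist p (g • p) + dist p (h • p) := by
  obtain ⟨d1, d2, d3, d4, d5⟩ := b.dirs
  exact Ax.of_mul b.hg.1 b.h_ne d3 d2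

theorem Bridge.three {g h : G} {p q : X} (b : Bridge g h p q) {k : G} (hk : k • p ≠ p) :
    ∃ a : G, (a = g ∨ a = g⁻¹ ∨ a = h) ∧ Ax (a * k) p ∧
      dist p ((a * k) • p) = dist p (a • p) + dist p (k • p) := by
  obtain ⟨d1, d2, d3, d4, d5⟩ := b.dirs
  have A1 := d1.either (k • p)
  have A2 := d2.either (k • p)
  have A3 := d3.either (k • p)
  have A4 := d4.either (k • p)
  have A5 := d5.either (k • p)
  have B1 := d1.either (k⁻¹ • p)
  have B2 := d2.either (k⁻¹ • p)
  have B3 := d3.either (k⁻¹ • p)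
  have B4 := d4.either (k⁻¹ • p)
  have B5 := d5.either (k⁻¹ • p)
  have main : (Bt (k • p) p (g⁻¹ • p) ∧ Bt (k⁻¹ • p) p (g • p)) ∨
      (Bt (k • p) p (g • p) ∧ Bt (k⁻¹ • p) p (g⁻¹ • p)) ∨
      (Bt (k • p) p (h⁻¹ • p) ∧ Bt (k⁻¹ • p) p (h • p)) := by
    tauto
  rcases main with ⟨m1, m2⟩ | ⟨m1, m2⟩ | ⟨m1, m2⟩
  · exact ⟨g, Or.inl rfl, Ax.of_mul b.hg.1 hk m1.symm m2.symm⟩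
  · exact ⟨g⁻¹, Or.inr (Or.inl rfl), Ax.of_mul b.hg.inv.1 hk (by simpa using m1.symm) m2.symm⟩
  · exact ⟨h, Or.inr (Or.inr rfl), Ax.of_mul b.h_ne hk m1.symm m2.symm⟩

theorem four_point {x y : X} {a b : Bool → X} (ha : Bt (a true) x (a false))
    (hb : Bt (b true) y (b false)) :
    ∃ i j, dist (a i) (b j) = dist (a i) x + dist x y + dist (b j) y := by
  obtain ⟨i, hi⟩ : ∃ i, Bt y x (a i) := by
    rcases ha.either y with h | h
    · exact ⟨_, h⟩
    · exact ⟨_, h⟩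
  obtain ⟨j, hj⟩ : ∃ j, Bt (a i) y (b j) := by
    rcases hb.either (a i) with h | h
    · exact ⟨_, h⟩
    · exact ⟨_, h⟩
  refine ⟨i, j, ?_⟩
  have h1 := hi.symm
  unfold Bt at h1 hj
  rw [← hj, ← h1, dist_comm y (b j)]

theorem four_point_le {Y : Type u} [MetricSpace Y] {x y : X} {a b : Bool → X}
    {x' y' : Y} {a' b' : Bool → Y} {δ : ℝ} (ha : Bt (a true) x (a false))
    (hb : Bt (b true) y (b false))
    (h1 : ∀ i j, |dist (a i) (b j) - dist (a' i) (b' j)| < δ)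
    (h2 : ∀ i, |dist (a i) x - dist (a' i) x'| < 2 * δ)
    (h3 : ∀ i, |dist (b i) y - dist (b' i) y'| < 2 * δ) :
    dist x y < dist x' y' + 5 * δ := by
  obtain ⟨i, j, h⟩ := four_point ha hb
  have e1 := abs_lt.1 (h1 i j)
  have e2 := abs_lt.1 (h2 i)
  have e3 := abs_lt.1 (h3 j)
  have t1 := dist_triangle (a' i) x' (b' j)
  have t2 := dist_triangle x' y' (b' j)
  rw [dist_comm y' (b' j)] at t2
  linarith

theorem four_point_close {Y : Type u} [MetricSpace Y] [MTree Y] {x y : X} {a b : Bool → X}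
    {x' y' : Y} {a' b' : Bool → Y} {δ : ℝ} (ha : Bt (a true) x (a false))
    (hb : Bt (b true) y (b false)) (ha' : Bt (a' true) x' (a' false))
    (hb' : Bt (b' true) y' (b' false))
    (h1 : ∀ i j, |dist (a i) (b j) - dist (a' i) (b' j)| < δ)
    (h2 : ∀ i, |dist (a i) x - dist (a' i) x'| < 2 * δ)
    (h3 : ∀ i, |dist (b i) y - dist (b' i) y'| < 2 * δ) :
    |dist x y - dist x' y'| < 5 * δ := by
  have e1 := four_point_le ha hb h1 h2 h3
  have e2 := four_point_le ha' hb' (fun i j => by rw [abs_sub_comm]; exact h1 i j)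
    (fun i => by rw [abs_sub_comm]; exact h2 i) (fun i => by rw [abs_sub_comm]; exact h3 i)
  rw [abs_lt]
  constructor <;> linarith

theorem hull_convex {x y z a a' b b' : X} (hx : Bt a x a') (hy : Bt b y b') (hz : Bt x z y) :
    ∃ c d, (c = a ∨ c = a' ∨ c = b ∨ c = b') ∧ (d = a ∨ d = a' ∨ d = b ∨ d = b') ∧
      Bt c z d := by
  by_cases h1 : z = x
  · rw [h1]; exact ⟨a, a', by tauto, by tauto, hx⟩
  by_cases h2 : z = y
  · rw [h2]; exact ⟨b, b', by tauto, by tauto, hy⟩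
  obtain ⟨c, hc, c1⟩ : ∃ c, (c = a ∨ c = a') ∧ Bt z x c := by
    rcases hx.either z with h | h
    · exact ⟨_, Or.inl rfl, h⟩
    · exact ⟨_, Or.inr rfl, h⟩
  obtain ⟨d, hd, d1⟩ : ∃ d, (d = b ∨ d = b') ∧ Bt z y d := by
    rcases hy.either z with h | h
    · exact ⟨_, Or.inl rfl, h⟩
    · exact ⟨_, Or.inr rfl, h⟩
  have e1 := (hz.chain d1 h2).1
  exact ⟨c, d, by tauto, by tauto, (c1.symm.chain e1 (Ne.symm h1)).2⟩

end BasePoint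

section AxesSub

variable {G : Type u} [Group G]

theorem RGTree.hull (R : RGTree G) (P x : R.X) :
    ∃ K : Bool → G, Bt (K true • P) x (K false • P) := by
  have key := R.minimal {x | ∃ k k' : G, Bt (k • P) x (k' • P)}
    ⟨P, 1, 1, by rw [one_smul]; exact bt_left _ _⟩
    (by
      rintro g x ⟨k, k', h⟩
      refine ⟨g * k, g * k', ?_⟩
      rw [mul_smul, mul_smul]
      exact h.smul g)
    (by
      rintro x ⟨k, k', hx⟩ y ⟨l, l', hy⟩ z hz
      obtain ⟨c, d, hc, hd, h⟩ := hull_convex hx hy hz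
      have hc' : ∃ m : G, c = m • P := by
        rcases hc with h | h | h | h <;> exact ⟨_, h⟩
      have hd' : ∃ m : G, d = m • P := by
        rcases hd with h | h | h | h <;> exact ⟨_, h⟩
      obtain ⟨m, rfl⟩ := hc'
      obtain ⟨m', rfl⟩ := hd'
      exact ⟨m, m', h⟩)
  have hx : x ∈ {x | ∃ k k' : G, Bt (k • P) x (k' • P)} := by rw [key]; trivial
  obtain ⟨k, k', h⟩ := hx
  exact ⟨fun i => if i then k else k', by simpa using h⟩

theorem RGTree.ell_mul_le (R : RGTree G) (a k : G) (p : R.X) :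
    R.ell (a * k) ≤ dist p (a • p) + dist p (k • p) := by
  have h := R.ell_le (a * k) p
  rw [mul_smul] at h
  have t := dist_triangle p (a • p) (a • k • p)
  rw [dist_smul] at t
  linarith

theorem bridge_le {R R' : RGTree G} {g h : G} {P Q : R.X} {P' Q' : R'.X}
    (b : Bridge g h P Q) (b' : Bridge g h P' Q') {δ : ℝ} {k : G}
    (e1 : |R'.ell g - R.ell g| < δ) (e2 : |R'.ell (g * h) - R.ell (g * h)| < δ)
    (e3 : |R'.ell (g * k) - R.ell (g * k)| < δ) (e4 : |R'.ell (g⁻¹ * k) - R.ell (g⁻¹ * k)| < δ)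
    (e5 : |R'.ell (h * k) - R.ell (h * k)| < δ) :
    dist P (k • P) < dist P' (k • P') + 3 * δ := by
  rw [abs_lt] at *
  have δ0 : 0 < δ := by linarith
  by_cases hk : k • P = P
  · rw [hk, dist_self]
    have := dist_nonneg (x := P') (y := k • P')
    linarith
  have l1 := R.ell_ax b.hg
  have l1' := R'.ell_ax b'.hg
  have l2 := R.ell_ax b.gh.1
  have l2' := R'.ell_ax b'.gh.1
  rw [b.gh.2] at l2
  rw [b'.gh.2] at l2'
  obtain ⟨a, ha, h1, h2⟩ := b.three hk
  have h3 := R.ell_ax h1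
  rw [h2] at h3
  have h4 := R'.ell_mul_le a k P'
  rcases ha with rfl | rfl | rfl
  · linarith
  · rw [dist_inv_smul_self] at h3 h4
    linarith
  · linarith

theorem exists_bridge_of_ell (R : RGTree G) {g h : G} (h1 : 0 < R.ell g) (h2 : 0 < R.ell h)
    (h3 : R.ell g + R.ell h < R.ell (g * h)) : ∃ P Q : R.X, Bridge g h P Q := by
  obtain ⟨a, ha⟩ := R.ax_of_hyp (R.hyp_of_pos h1)
  obtain ⟨b, hb⟩ := R.ax_of_hyp (R.hyp_of_pos h2)
  refine ha.exists_bridge hb fun x hx hx' => ?_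
  have := R.ell_mul_le g h x
  rw [← R.ell_ax hx, ← R.ell_ax hx'] at this
  linarith

theorem base_close (D : Set (RGTree G)) (R : RGTree G) (hR : R ∈ @closure _ (axesTopR G) D)
    {g h : G} {P Q : R.X} (b : Bridge g h P Q) (M : Finset G) {δ : ℝ} (hδ : 0 < δ) :
    ∃ R' ∈ D, ∃ P' : R'.X, ∀ m ∈ M, |dist P (m • P) - dist P' (m • P')| < δ := by
  rw [axes_iff] at hR
  have p1 : 0 < R.ell g := by rw [R.ell_ax b.hg]; exact b.hg.pos
  have p2 : 0 < R.ell h := by rw [R.ell_ax b.hh]; exact b.hh.pos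
  have p3 : R.ell (g * h) = R.ell g + R.ell h + 2 * dist P Q := by
    rw [R.ell_ax b.gh.1, b.gh.2, b.dist_h, R.ell_ax b.hg, R.ell_ax b.hh]; ring
  have p4 : 0 < dist P Q := dist_pos.2 b.ne
  obtain ⟨η, hη⟩ : ∃ η : ℝ, η = min (min (R.ell g) (R.ell h)) (min (dist P Q / 2) (δ / 3)) :=
    ⟨_, rfl⟩
  have q0 : 0 < η := by
    rw [hη]
    exact lt_min (lt_min p1 p2) (lt_min (by linarith) (by linarith))
  have q1 : η ≤ R.ell g := by rw [hη]; exact (min_le_left _ _).trans (min_le_left _ _)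
  have q2 : η ≤ R.ell h := by rw [hη]; exact (min_le_left _ _).trans (min_le_right _ _)
  have q3 : η ≤ dist P Q / 2 := by rw [hη]; exact (min_le_right _ _).trans (min_le_left _ _)
  have q4 : η ≤ δ / 3 := by rw [hη]; exact (min_le_right _ _).trans (min_le_right _ _)
  obtain ⟨R', hR', hF⟩ := hR ({g, h, g * h} ∪ M.image (fun m => g * m) ∪
    M.image (fun m => g⁻¹ * m) ∪ M.image (fun m => h * m)) η q0
  have r1 := hF g (by simp)
  have r2 := hF h (by simp)
  have r3 := hF (g * h) (by simp)
  obtain ⟨P', Q', b'⟩ : ∃ P' Q' : R'.X, Bridge g h P' Q' := by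
    have r1 := abs_lt.1 r1
    have r2 := abs_lt.1 r2
    have r3 := abs_lt.1 r3
    exact exists_bridge_of_ell R' (by linarith) (by linarith) (by linarith)
  refine ⟨R', hR', P', fun m hm => ?_⟩
  have s1 := hF (g * m) (by
    simp only [Finset.mem_union, Finset.mem_image]
    exact Or.inl (Or.inl (Or.inr ⟨m, hm, rfl⟩)))
  have s2 := hF (g⁻¹ * m) (by
    simp only [Finset.mem_union, Finset.mem_image]
    exact Or.inl (Or.inr ⟨m, hm, rfl⟩))
  have s3 := hF (h * m) (by
    simp only [Finset.mem_union, Finset.mem_image]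
    exact Or.inr ⟨m, hm, rfl⟩)
  have u1 := bridge_le b b' r1 r3 s1 s2 s3
  rw [abs_sub_comm] at r1 r3 s1 s2 s3
  have u2 := bridge_le b' b r1 r3 s1 s2 s3
  rw [abs_lt]
  constructor <;> linarith

theorem axes_sub_gromov (D : Set (RGTree G)) (R : RGTree G)
    (hR : R ∈ @closure _ (axesTopR G) D) (hirr : R.Irr) : R ∈ @closure _ (gromovTopR G) D := by
  obtain ⟨g, h, hg, hh, hd⟩ := hirr
  obtain ⟨a, ha⟩ := R.ax_of_hyp hg
  obtain ⟨b, hb⟩ := R.ax_of_hyp hh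
  obtain ⟨P, Q, br⟩ := ha.exists_bridge hb (fun x h1 h2 => by
    have : x ∈ R.Axis g ∩ R.Axis h :=
      ⟨(R.mem_axis_hyp hg x).2 h1, (R.mem_axis_hyp hh x).2 h2⟩
    rw [hd] at this
    exact this)
  rw [gromov_iff]
  intro X A ε hε
  choose K hK using R.hull P
  obtain ⟨R', hR', P', hM⟩ := base_close D R hR br
    ((((X ×ˢ X) ×ˢ (insert 1 A)) ×ˢ (Finset.univ : Finset (Bool × Bool))).image
      (fun q => (K q.1.1.1 q.2.1)⁻¹ * q.1.2 * K q.1.1.2 q.2.2)) (δ := ε / 5) (by linarith)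
  have hM' : ∀ x ∈ X, ∀ y ∈ X, ∀ m ∈ insert 1 A, ∀ i j,
      |dist (K x i • P) (m • K y j • P) - dist (K x i • P') (m • K y j • P')| < ε / 5 := by
    intro x hx y hy m hm i j
    have := hM ((K x i)⁻¹ * m * K y j) (by
      rw [Finset.mem_image]
      exact ⟨(((x, y), m), (i, j)), by simp [hx, hy, Finset.mem_insert.1 hm], rfl⟩)
    have e : ∀ {Y : Type u} [MetricSpace Y] [MTree Y] [MulAction G Y] [IsIsometricSMul G Y] (p : Y),
        dist p (((K x i)⁻¹ * m * K y j) • p) = dist (K x i • p) (m • K y j • p) := by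
      intro Y _ _ _ _ p
      rw [mul_smul, mul_smul, dist_comm, dist_inv_smul, dist_comm]
    rwa [e, e] at this
  have hf : ∀ x : R.X, ∃ z : R'.X, Bt (K x true • P') z (K x false • P') ∧
      dist (K x true • P') z =
        min (dist (K x true • P) x) (dist (K x true • P') (K x false • P')) := fun x =>
    R'.pt _ _ (le_min dist_nonneg dist_nonneg) (min_le_right _ _)
  choose f f1 f2 using hf
  have hend : ∀ x ∈ X, ∀ i, |dist (K x i • P) x - dist (K x i • P') (f x)| < 2 * (ε / 5) := by
    intro x hx i
    have c := hM' x hx x hx 1 (Finset.mem_insert_self _ _) true false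
    rw [one_smul, one_smul, abs_lt] at c
    have h1 := hK x
    have h2 := f1 x
    have h3 := f2 x
    unfold Bt at h1 h2
    have n1 := dist_nonneg (x := K x true • P) (y := x)
    have n2 := dist_nonneg (x := x) (y := K x false • P)
    rw [abs_lt]
    cases i
    · rw [dist_comm _ x, dist_comm _ (f x)]
      rcases min_cases (dist (K x true • P) x) (dist (K x true • P') (K x false • P'))
        with ⟨m1, m2⟩ | ⟨m1, m2⟩ <;> rw [m1] at h3 <;> constructor <;> linarith
    · rcases min_cases (dist (K x true • P) x) (dist (K x true • P') (K x false • P'))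
        with ⟨m1, m2⟩ | ⟨m1, m2⟩ <;> rw [m1] at h3 <;> constructor <;> linarith
  refine ⟨R', hR', f, fun x hx y hy m hm => ?_⟩
  have := four_point_close (x := x) (y := m • y) (x' := f x) (y' := m • f y)
    (a := fun i => K x i • P) (b := fun i => m • K y i • P)
    (a' := fun i => K x i • P') (b' := fun i => m • K y i • P') (δ := ε / 5)
    (hK x) ((hK y).smul m) (f1 x) ((f1 y).smul m)
    (fun i j => hM' x hx y hy m (Finset.mem_insert_of_mem hm) i j)
    (hend x hx) (fun i => by
      simp only [dist_smul]
      exact hend y hy i)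
  linarith

end AxesSub

/-- **Proposition (Guirardel–Levitt, Proposition 5.8).** Let `D` be an irreducible
deformation space and `D̄` its closure in the space of non-trivial minimal `ℝ`-trees
with the Gromov topology.  For `T ∈ D̄`: (1) if `g` is hyperbolic in `D` but elliptic in
`T`, its fixed point set contains no tripod; (2) if `g, h, [g,h]` are hyperbolic in `D`,
then `A_g ∩ A_h` is a segment of length at most `ℓ(g) + ℓ(h)`; (3) `T` is irreducible;
(4) `D̄` is also the closure of `D` in the axes topology. -/
theorem statement_10 {G : Type u} [Group G] [Group.FG G] (T₀ : MGTree G)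
    (hirr : T₀.Irr) (Dset : Set (RGTree G))
    (hDset : Dset = {R : RGTree G |
      ∃ T : MGTree G, SameDef T₀.toGTree T.toGTree ∧ RealizationOf R T})
    (R : RGTree G) (hR : R ∈ @closure _ (gromovTopR G) Dset) :
    (∀ g : G, T₀.toGTree.Hyperbolic g → (∃ x : R.X, R.act g x = x) →
      ∀ a ∈ R.Fix g, ∀ b ∈ R.Fix g, ∀ c ∈ R.Fix g,
        R.Btw a b c ∨ R.Btw b a c ∨ R.Btw a c b) ∧
    (∀ g h : G, T₀.toGTree.Hyperbolic g → T₀.toGTree.Hyperbolic h →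
      T₀.toGTree.Hyperbolic (g * h * g⁻¹ * h⁻¹) →
      (∀ x ∈ R.Axis g ∩ R.Axis h, ∀ y ∈ R.Axis g ∩ R.Axis h,
        (∀ z : R.X, R.Btw x z y → z ∈ R.Axis g ∩ R.Axis h) ∧
          dist x y ≤ R.ell g + R.ell h)) ∧
    R.Irr ∧
    @closure _ (gromovTopR G) Dset = @closure _ (axesTopR G) Dset := by
  have hD : ∀ R' ∈ Dset, ∀ g : G, T₀.toGTree.Hyperbolic g ↔ R'.Hyperbolic g := by
    subst hDset
    rintro R' ⟨T, h1, h2⟩ g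
    exact (h1.hyp_iff g).trans (h2.hyp_iff g)
  refine ⟨?_, ?_, part_three T₀ hirr Dset hD R (gromov_sub_axes Dset hR), ?_⟩
  · intro g hg _ a ha b hb c hc
    exact part_one Dset R hR g (fun R' h' => (hD R' h' g).1 hg) ha hb hc
  · intro g h hg hh hgh x hx y hy
    refine ⟨fun z hz => ⟨R.axis_convex hx.1 hy.1 hz, R.axis_convex hx.2 hy.2 hz⟩, ?_⟩
    exact part_two Dset R hR g h (fun R' h' => (hD R' h' g).1 hg)
      (fun R' h' => (hD R' h' h).1 hh) (fun R' h' => (hD R' h' _).1 hgh) hx.1 hx.2 hy.1 hy.2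
  · apply Set.Subset.antisymm (gromov_sub_axes Dset)
    intro R' hR'
    exact axes_sub_gromov Dset R' hR' (part_three T₀ hirr Dset hD R' hR')
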